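/- arXiv:2501.09956 — 2 statements merged into one kernel-verified Lean document; each statement's English description precedes it below -/
import Mathlib

section
/- Let s > 5/2. There exists a constant C = C(s) > 0 such that for every smooth divergence-free vector field b on 𝕋³ with zero mean and every smooth real-valued function f on 𝕋³ with zero mean, the double commutator satisfies ‖[[Λ^s, b·∇], b·∇] f‖_{L²(𝕋³)} ≤ C ‖b‖²_{H^{s+1}} ‖f‖_{H^s}. -/
/-!
We model functions on the torus `𝕋³ = ℝ³/ℤ³` by their Fourier coefficients,
indexed by `n ∈ ℤ³` (the actual frequency being `k = 2πn ∈ 2πℤ³`).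
Smoothness corresponds to rapid decay of the Fourier coefficients, real-valuedness
to the usual conjugation symmetry, products to convolution of coefficients, and
the `L²` norm/inner product are given by Plancherel.
-/

noncomputable section

open scoped BigOperators
open Complex

/-- Fourier frequencies of functions on `𝕋³`, indexed by `n ∈ ℤ³`; the actual
frequency is `k = 2πn ∈ 2πℤ³`. -/
abbrev Z3 : Type := Fin 3 → ℤ

/-- The Euclidean length `|k|` of the frequency `k = 2πn`. -/
def knorm (n : Z3) : ℝ := 2 * Real.pi * Real.sqrt (∑ i, ((n i : ℝ)) ^ 2)

/-- `Λ^s = (−Δ)^{s/2}` as a Fourier multiplier: `(Λ^s f)^_k = |k|^s f^_k`. -/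
def lam (s : ℝ) (c : Z3 → ℂ) : Z3 → ℂ :=
  fun n => Complex.ofReal (knorm n ^ s) * c n

/-- Squared `L²(𝕋³)` norm (Plancherel). -/
def l2sq (c : Z3 → ℂ) : ℝ := ∑' n : Z3, ‖c n‖ ^ 2

/-- `L²(𝕋³)` norm. -/
def l2norm (c : Z3 → ℂ) : ℝ := Real.sqrt (l2sq c)

/-- `L²(𝕋³)` inner product of two real-valued functions (Plancherel). -/
def inner2 (c d : Z3 → ℂ) : ℝ := (∑' n : Z3, c n * (starRingEnd ℂ) (d n)).re

/-- Sobolev `H^σ` norm: `(∑_k (1+|k|^{2σ})|f^_k|²)^{1/2}`. -/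
def hnorm (σ : ℝ) (c : Z3 → ℂ) : ℝ :=
  Real.sqrt (∑' n : Z3, (1 + knorm n ^ (2 * σ)) * ‖c n‖ ^ 2)

/-- The partial derivative `∂_j` as a Fourier multiplier. -/
def pd (j : Fin 3) (c : Z3 → ℂ) : Z3 → ℂ :=
  fun n => Complex.I * Complex.ofReal (2 * Real.pi * (n j : ℝ)) * c n

/-- Pointwise product of two functions = convolution of Fourier coefficients. -/
def conv (c d : Z3 → ℂ) : Z3 → ℂ := fun n => ∑' m : Z3, c m * d (n - m)

/-- The coefficients of a real-valued function. -/
def IsRealFn (c : Z3 → ℂ) : Prop := ∀ n : Z3, c (-n) = (starRingEnd ℂ) (c n)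

/-- Rapid decay of the Fourier coefficients, i.e. smoothness of the function. -/
def RapidDecay (c : Z3 → ℂ) : Prop :=
  ∀ N : ℕ, ∃ C : ℝ, ∀ n : Z3, ‖c n‖ * (1 + knorm n) ^ N ≤ C

/-- A smooth real-valued function on `𝕋³`, described by its Fourier coefficients. -/
def SmoothFun (c : Z3 → ℂ) : Prop := IsRealFn c ∧ RapidDecay c

/-- Zero mean. -/
def ZeroMean (c : Z3 → ℂ) : Prop := c 0 = 0

/-- A divergence-free vector field `b = (b¹,b²,b³)`: `∀ k, ∑_j k_j b^j_k = 0`. -/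
def DivFree (b : Fin 3 → Z3 → ℂ) : Prop :=
  ∀ n : Z3, ∑ j : Fin 3, (n j : ℂ) * b j n = 0

/-- The transport operator `b·∇ = b¹∂_{x₁} + b²∂_{x₂} + b³∂_z`. -/
def transport (b : Fin 3 → Z3 → ℂ) (c : Z3 → ℂ) : Z3 → ℂ :=
  fun n => ∑ j : Fin 3, conv (b j) (pd j c) n

/-- The commutator `[Λ^s, b·∇]`. -/
def commLam (s : ℝ) (b : Fin 3 → Z3 → ℂ) (c : Z3 → ℂ) : Z3 → ℂ :=
  lam s (transport b c) - transport b (lam s c)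

/-- `H^σ` norm of a 3-component vector field. -/
def hnormV3 (σ : ℝ) (b : Fin 3 → Z3 → ℂ) : ℝ :=
  Real.sqrt (∑ j : Fin 3, (hnorm σ (b j)) ^ 2)

/-- `Λ^s` acting componentwise on ℝ²-valued functions. -/
def lamV (s : ℝ) (V : Fin 2 → Z3 → ℂ) : Fin 2 → Z3 → ℂ := fun i => lam s (V i)

/-- `b·∇` acting componentwise on ℝ²-valued functions. -/
def transportV (b : Fin 3 → Z3 → ℂ) (V : Fin 2 → Z3 → ℂ) : Fin 2 → Z3 → ℂ :=
  fun i => transport b (V i)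

/-- `[Λ^s, b·∇]` acting componentwise on ℝ²-valued functions. -/
def commLamV (s : ℝ) (b : Fin 3 → Z3 → ℂ) (V : Fin 2 → Z3 → ℂ) : Fin 2 → Z3 → ℂ :=
  fun i => commLam s b (V i)

/-- `L²` norm of an ℝ²-valued function. -/
def l2normV (V : Fin 2 → Z3 → ℂ) : ℝ := Real.sqrt (∑ i : Fin 2, l2sq (V i))

/-- `L²` inner product of ℝ²-valued functions. -/
def inner2V (V W : Fin 2 → Z3 → ℂ) : ℝ := ∑ i : Fin 2, inner2 (V i) (W i)

/-- `H^σ` norm of an ℝ²-valued function. -/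
def hnormV2 (σ : ℝ) (V : Fin 2 → Z3 → ℂ) : ℝ :=
  Real.sqrt (∑ i : Fin 2, (hnorm σ (V i)) ^ 2)

/-- The hydrostatic Leray projection `𝒫φ = φ − ∇_h Δ_h^{-1} ∇_h · φ̄` as a Fourier
multiplier: the barotropic part `φ̄` consists of the modes with `n₃ = 0`, on which
`∇_h Δ_h^{-1} ∇_h ·` acts as `φ̂ ↦ n_h (n_h · φ̂)/|n_h|²` (for `n_h ≠ 0`). -/
def hproj (V : Fin 2 → Z3 → ℂ) : Fin 2 → Z3 → ℂ := fun i n =>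
  if n 2 = 0 ∧ ¬(n 0 = 0 ∧ n 1 = 0) then
    V i n - (n i.castSucc : ℂ) * ((n 0 : ℂ) * V 0 n + (n 1 : ℂ) * V 1 n) /
      (((n 0 : ℂ)) ^ 2 + ((n 1 : ℂ)) ^ 2)
  else V i n

/-- `ℚ = I − 𝒫`. -/
def qproj (V : Fin 2 → Z3 → ℂ) : Fin 2 → Z3 → ℂ := fun i => V i - hproj V i

/-- The commutator `[𝒫, b·∇]` on ℝ²-valued functions. -/
def commProj (b : Fin 3 → Z3 → ℂ) (V : Fin 2 → Z3 → ℂ) : Fin 2 → Z3 → ℂ :=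
  fun i => hproj (transportV b V) i - transportV b (hproj V) i

/-- A smooth ℝ²-valued function on `𝕋³`. -/
def SmoothV2 (V : Fin 2 → Z3 → ℂ) : Prop := ∀ i, SmoothFun (V i)

/-- A smooth vector field on `𝕋³`. -/
def SmoothV3 (b : Fin 3 → Z3 → ℂ) : Prop := ∀ j, SmoothFun (b j)

/-- `∂_z b^h = ∂_z (b¹, b²)`. -/
def dzbh (b : Fin 3 → Z3 → ℂ) : Fin 2 → Z3 → ℂ := fun i => pd 2 (b i.castSucc)

/-- `𝒫B V = 𝒫(b·∇V)`. -/
def PB (b : Fin 3 → Z3 → ℂ) (V : Fin 2 → Z3 → ℂ) : Fin 2 → Z3 → ℂ :=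
  hproj (transportV b V)

theorem aux_phi1 {σ R u v : ℝ} (hσ : 1 < σ) (hR : 0 < R) (hu : u ∈ Set.Icc (R/4) (4*R))
    (hv : v ∈ Set.Icc (R/4) (4*R)) :
    |u ^ σ - v ^ σ| ≤ σ * (4*R)^(σ-1) * |u - v| := by
  have := Convex.norm_image_sub_le_of_norm_hasDerivWithin_le (f := fun r : ℝ => r ^ σ)
    (f' := fun r : ℝ => σ * r ^ (σ - 1)) (s := Set.Icc (R/4) (4*R)) (C := σ * (4*R)^(σ-1))
    (x := v) (y := u) ?_ ?_ (convex_Icc _ _) hv hu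
  · simpa [Real.norm_eq_abs] using this
  · intro x hx
    exact (Real.hasDerivAt_rpow_const (Or.inr hσ.le)).hasDerivWithinAt
  · intro x hx
    have hx0 : 0 ≤ x := by have := hx.1; linarith
    rw [Real.norm_eq_abs, abs_of_nonneg (by positivity)]
    gcongr
    exact hx.2

theorem aux_phi1' {σ R u v : ℝ} (hσ : 1 < σ) (hR : 0 < R) (hu : u ∈ Set.Icc (R/4) (4*R))
    (hv : v ∈ Set.Icc (R/4) (4*R)) :
    |u ^ (σ-1) - v ^ (σ-1)| ≤ (σ-1) * ((4*R)^(σ-1) * (4/R)) * |u - v| := by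
  have := Convex.norm_image_sub_le_of_norm_hasDerivWithin_le (f := fun r : ℝ => r ^ (σ-1))
    (f' := fun r : ℝ => (σ-1) * r ^ (σ - 1 - 1)) (s := Set.Icc (R/4) (4*R))
    (C := (σ-1) * ((4*R)^(σ-1) * (4/R)))
    (x := v) (y := u) ?_ ?_ (convex_Icc _ _) hv hu
  · simpa [Real.norm_eq_abs] using this
  · intro x hx
    have hx0 : 0 < x := by have := hx.1; linarith
    exact (Real.hasDerivAt_rpow_const (Or.inl hx0.ne')).hasDerivWithinAt
  · intro x hx
    have hx0 : 0 < x := by have := hx.1; linarith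
    have h1 : 0 ≤ σ - 1 := by linarith
    rw [Real.norm_eq_abs, abs_of_nonneg (by positivity), Real.rpow_sub hx0 (σ-1) 1, Real.rpow_one]
    have h2 : x⁻¹ ≤ 4 / R := by
      rw [inv_le_comm₀ hx0 (by positivity), inv_div]; exact hx.1
    rw [div_eq_mul_inv]
    gcongr
    exact hx.2

theorem aux_phi2 {σ R q a b : ℝ} (hσ : 1 < σ) (hR : 0 < R) (h0 : q ∈ Set.Icc (R/4) (4*R))
    (h1 : q + a ∈ Set.Icc (R/4) (4*R)) (h2 : q + b ∈ Set.Icc (R/4) (4*R))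
    (h3 : q + a + b ∈ Set.Icc (R/4) (4*R)) :
    |(q+a+b)^σ - (q+a)^σ - (q+b)^σ + q^σ| ≤
      σ * ((σ-1) * ((4*R)^(σ-1) * (4/R))) * |b| * |a| := by
  have hσ1 : 0 ≤ σ - 1 := by linarith
  have := Convex.norm_image_sub_le_of_norm_hasDerivWithin_le
    (f := fun r : ℝ => (r + b) ^ σ - r ^ σ)
    (f' := fun r : ℝ => σ * (r+b) ^ (σ - 1) - σ * r ^ (σ-1)) (s := Set.uIcc q (q+a))
    (C := σ * ((σ-1) * ((4*R)^(σ-1) * (4/R))) * |b|)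
    (x := q) (y := q + a) ?_ ?_ (convex_uIcc _ _) Set.left_mem_uIcc Set.right_mem_uIcc
  · simp only [Real.norm_eq_abs, add_sub_cancel_left] at this
    convert this using 2
    ring
  · intro x hx
    have e1 := (Real.hasDerivAt_rpow_const (x := x) (p := σ) (Or.inr hσ.le))
    have e2 := (Real.hasDerivAt_rpow_const (x := x + b) (p := σ) (Or.inr hσ.le)).comp_add_const x b
    exact (e2.sub e1).hasDerivWithinAt
  · intro x hx
    have hx1 : x ∈ Set.Icc (R/4) (4*R) := Set.OrdConnected.uIcc_subset Set.ordConnected_Icc h0 h1 hx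
    have hx2 : x + b ∈ Set.Icc (R/4) (4*R) := by
      have : x + b ∈ Set.uIcc (q + b) (q + a + b) := by
        rw [Set.mem_uIcc] at hx ⊢
        rcases hx with h | h
        · left; constructor <;> linarith [h.1, h.2]
        · right; constructor <;> linarith [h.1, h.2]
      exact Set.OrdConnected.uIcc_subset Set.ordConnected_Icc h2 h3 this
    have := aux_phi1' hσ hR hx2 hx1
    rw [add_sub_cancel_left] at this
    rw [← mul_sub, Real.norm_eq_abs, abs_mul, abs_of_pos (by linarith : 0 < σ), mul_assoc σ]
    gcongr

section
variable {E : Type*} [NormedAddCommGroup E] [InnerProductSpace ℝ E]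

theorem aux_normpow (s : ℝ) (v : E) : ‖v‖ ^ s = (‖v‖^2) ^ (s/2) := by
  rw [← Real.rpow_natCast, ← Real.rpow_mul (norm_nonneg _)]
  congr 1; push_cast; ring

def PhiB (s P A B : ℝ) : ℝ := P^s * A^2 * B^2 + P * A^(s+1) * B^2 + P * A^2 * B^(s+1)

theorem PhiB_swap (s P A B : ℝ) : PhiB s P A B = PhiB s P B A := by
  unfold PhiB; ring

theorem PhiB_nonneg (s P A B : ℝ) (hP : 0 ≤ P) (hA : 0 ≤ A) (hB : 0 ≤ B) : 0 ≤ PhiB s P A B := by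
  unfold PhiB; positivity

theorem PhiB_far {s P A B M : ℝ} (hP : 0 ≤ P) (hA : 1 ≤ A) (hB : 1 ≤ B) (hM : M = max A B) :
    P * M^(s+1) ≤ PhiB s P A B := by
  have hA2 : 1 ≤ A^2 := one_le_pow₀ hA
  have hB2 : 1 ≤ B^2 := one_le_pow₀ hB
  have h0 : 0 ≤ P^s * A^2 * B^2 := by positivity
  have h1 : 0 ≤ P * A^(s+1) := by positivity
  have h2 : 0 ≤ P * B^(s+1) := by positivity
  unfold PhiB
  rcases max_choice A B with h | h
  · rw [hM, h]
    nlinarith [mul_le_mul_of_nonneg_left hB2 h1, mul_nonneg h2 (sq_nonneg A)]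
  · rw [hM, h]
    nlinarith [mul_le_mul_of_nonneg_left hA2 h2, mul_nonneg h1 (sq_nonneg B)]

theorem sq_bounds {p x : E} (hx : ‖x‖ ≤ ‖p‖/8) :
    |‖p+x‖^2 - ‖p‖^2| ≤ 17/8 * ‖p‖ * ‖x‖ := by
  have h := norm_add_sq_real p x
  have h2 := abs_le.1 (abs_real_inner_le_norm p x)
  have := norm_nonneg x
  have := norm_nonneg p
  rw [abs_le]; constructor <;> nlinarith

theorem aux_second (s : ℝ) (hs : 5/2 < s) (p x y : E) (hp : 0 < ‖p‖) (hx : ‖x‖ ≤ ‖p‖/8)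
    (hy : ‖y‖ ≤ ‖p‖/8) :
    |‖p+x+y‖^s - ‖p+x‖^s - ‖p+y‖^s + ‖p‖^s| * ‖p‖^2 ≤
      (4^(s/2-1) * (s/2) * (2 + 20*(s/2-1))) * (‖p‖^s * ‖x‖ * ‖y‖) := by
  simp only [aux_normpow s]
  set σ := s/2 with hσd
  have hσ : 1 < σ := by rw [hσd]; linarith
  set R := ‖p‖^2 with hR
  have hRp : 0 < R := by positivity
  obtain ⟨a, ha⟩ : ∃ a, a = ‖p+x‖^2 - R := ⟨_, rfl⟩
  obtain ⟨b, hb⟩ : ∃ b, b = ‖p+y‖^2 - R := ⟨_, rfl⟩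
  have ha' := sq_bounds hx
  have hb' := sq_bounds hy
  rw [← hR, ← ha] at ha'
  rw [← hR, ← hb] at hb'
  have hx0 := norm_nonneg x
  have hy0 := norm_nonneg y
  have e1 : ‖p+x+y‖^2 = R + a + b + 2 * inner ℝ x y := by
    rw [ha, hb, hR, norm_add_sq_real (p+x) y, norm_add_sq_real p y, inner_add_left]; ring
  have hin := abs_real_inner_le_norm x y
  have hain : |a| ≤ 17/64 * R := ha'.trans (by rw [hR]; nlinarith)
  have hbin : |b| ≤ 17/64 * R := hb'.trans (by rw [hR]; nlinarith)
  have hxy : ‖x‖ * ‖y‖ ≤ R / 64 := by rw [hR]; nlinarith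
  rw [show ‖p+x‖^2 = R + a by rw [ha]; ring, show ‖p+y‖^2 = R + b by rw [hb]; ring, e1]
  have A1 := abs_le.1 hain
  have A2 := abs_le.1 hbin
  have A3 := abs_le.1 (hin.trans hxy)
  have f1 := aux_phi1 (u := R + a + b + 2 * inner ℝ x y) (v := R + a + b) hσ hRp
    ⟨by linarith, by linarith⟩ ⟨by linarith, by linarith⟩
  have f2 := aux_phi2 (q := R) (a := a) (b := b) hσ hRp
    ⟨by linarith, by linarith⟩ ⟨by linarith, by linarith⟩
    ⟨by linarith, by linarith⟩ ⟨by linarith, by linarith⟩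
  rw [add_sub_cancel_left, abs_mul, abs_two] at f1
  have hσ1 : 0 ≤ σ - 1 := by linarith
  have key : |(R + a + b + 2 * inner ℝ x y)^σ - (R+a)^σ - (R+b)^σ + R^σ| ≤
      σ * (4*R)^(σ-1) * (2 * (‖x‖*‖y‖)) +
      σ * ((σ-1) * ((4*R)^(σ-1) * (4/R))) * (17/8 * ‖p‖ * ‖y‖) * (17/8 * ‖p‖ * ‖x‖) := by
    calc _ = |((R + a + b + 2 * inner ℝ x y)^σ - (R+a+b)^σ) +
        ((R+a+b)^σ - (R+a)^σ - (R+b)^σ + R^σ)| := by congr 1; ring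
      _ ≤ _ := (abs_add_le _ _).trans (add_le_add (f1.trans ?_) (f2.trans ?_))
    · gcongr
    · gcongr
  have hRs : R^σ = R^(σ-1) * R := by
    rw [← Real.rpow_add_one hRp.ne']; congr 1; ring
  have h4 : (4*R)^(σ-1) = 4^(σ-1) * R^(σ-1) := Real.mul_rpow (by norm_num) hRp.le
  calc _ ≤ (σ * (4*R)^(σ-1) * (2 * (‖x‖*‖y‖)) +
      σ * ((σ-1) * ((4*R)^(σ-1) * (4/R))) * (17/8 * ‖p‖ * ‖y‖) * (17/8 * ‖p‖ * ‖x‖)) * R := by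
        gcongr
    _ = (4^(σ-1) * σ * (2 + (289/16)*(σ-1))) * (R^σ * ‖x‖ * ‖y‖) := by
        rw [hRs, h4]
        have : ‖p‖^2 = R := hR.symm
        field_simp
        rw [this]; ring
    _ ≤ _ := by gcongr; norm_num

theorem aux_first (s : ℝ) (hs : 5/2 < s) (p x : E) (hp : 0 < ‖p‖) (hx : ‖x‖ ≤ ‖p‖/4) :
    |‖p+x‖^s - ‖p‖^s| * ‖p‖ ≤ (4^(s/2-1) * (s/2) * 3) * (‖p‖^s * ‖x‖) := by
  simp only [aux_normpow s]
  set σ := s/2 with hσd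
  have hσ : 1 < σ := by rw [hσd]; linarith
  set R := ‖p‖^2 with hR
  have hRp : 0 < R := by positivity
  have hx0 := norm_nonneg x
  have hd : |‖p+x‖^2 - R| ≤ 9/4 * ‖p‖ * ‖x‖ := by
    have h := norm_add_sq_real p x
    have h2 := abs_le.1 (abs_real_inner_le_norm p x)
    rw [abs_le]; constructor <;> nlinarith
  have hd2 : |‖p+x‖^2 - R| ≤ 9/16 * R := hd.trans (by rw [hR]; nlinarith)
  have A1 := abs_le.1 hd2
  have f1 := aux_phi1 (u := ‖p+x‖^2) (v := R) hσ hRp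
    ⟨by linarith, by linarith⟩ ⟨by linarith, by linarith⟩
  have hRs : R^σ = R^(σ-1) * R := by
    rw [← Real.rpow_add_one hRp.ne']; congr 1; ring
  have h4 : (4*R)^(σ-1) = 4^(σ-1) * R^(σ-1) := Real.mul_rpow (by norm_num) hRp.le
  calc _ ≤ (σ * (4*R)^(σ-1) * (9/4 * ‖p‖ * ‖x‖)) * ‖p‖ := by
        gcongr; exact f1.trans (by gcongr)
    _ = (4^(σ-1) * σ * (9/4)) * (R^σ * ‖x‖) := by
        rw [hRs, h4, hR]; ring
    _ ≤ _ := by gcongr; norm_num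

theorem symb1 (s : ℝ) (hs : 5/2 < s) : ∃ C : ℝ, 0 < C ∧ ∀ p x y : E, 1 ≤ ‖x‖ → 1 ≤ ‖y‖ →
    |‖p+x+y‖^s - ‖p+x‖^s - ‖p+y‖^s + ‖p‖^s| * ‖p‖^2 ≤ C * PhiB s ‖p‖ ‖x‖ ‖y‖ ∧
    |‖p+x+y‖^s - 2 * ‖p+y‖^s + ‖p‖^s| * (‖y‖ * ‖p‖) ≤ C * PhiB s ‖p‖ ‖x‖ ‖y‖ := by
  have hs0 : 0 < s := by linarith
  have hs1 : 0 < s/2 - 1 := by linarith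
  obtain ⟨C1, hC1d⟩ : ∃ C1 : ℝ, C1 = 4^(s/2-1) * (s/2) * (2 + 20*(s/2-1)) := ⟨_, rfl⟩
  obtain ⟨C2, hC2d⟩ : ∃ C2 : ℝ, C2 = 4^(s/2-1) * (s/2) * 3 := ⟨_, rfl⟩
  have hC1 : 0 < C1 := by rw [hC1d]; positivity
  have hC2 : 0 < C2 := by rw [hC2d]; positivity
  have hC3 : (0:ℝ) < 32 * 10^s := by positivity
  refine ⟨C1 + 4 * C2 + 32 * 10^s, by positivity, fun p x y hx hy => ?_⟩
  have hp0 := norm_nonneg p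
  have hPhi := PhiB_nonneg s ‖p‖ ‖x‖ ‖y‖ hp0 (by linarith) (by linarith)
  by_cases hc : max ‖x‖ ‖y‖ ≤ ‖p‖/8
  · obtain ⟨hcx, hcy⟩ := max_le_iff.1 hc
    have hp : 0 < ‖p‖ := by linarith
    have hnear : ‖p‖^s * ‖x‖^2 * ‖y‖^2 ≤ PhiB s ‖p‖ ‖x‖ ‖y‖ := by
      unfold PhiB
      have : 0 ≤ ‖p‖ * ‖x‖^(s+1) * ‖y‖^2 := by positivity
      have : 0 ≤ ‖p‖ * ‖x‖^2 * ‖y‖^(s+1) := by positivity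
      linarith
    have hps : 0 < ‖p‖^s := by positivity
    constructor
    · refine (aux_second s hs p x y hp hcx hcy).trans ?_
      rw [← hC1d]
      have h1 : ‖p‖^s * ‖x‖ * ‖y‖ ≤ ‖p‖^s * ‖x‖^2 * ‖y‖^2 := by
        gcongr
        · nlinarith
        · nlinarith
      refine mul_le_mul ?_ (h1.trans hnear) (by positivity) (by positivity)
      linarith
    · have hxy : ‖x+y‖ ≤ ‖p‖/4 := (norm_add_le _ _).trans (by linarith)
      have f1 := aux_first s hs p (x+y) hp hxy
      have f2 := aux_first s hs p y hp (by linarith)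
      rw [← add_assoc, ← hC2d] at f1
      rw [← hC2d] at f2
      have hy0 : 0 ≤ ‖y‖ := by positivity
      calc |‖p+x+y‖^s - 2 * ‖p+y‖^s + ‖p‖^s| * (‖y‖ * ‖p‖)
          = |(‖p+x+y‖^s - ‖p‖^s) - 2 * (‖p+y‖^s - ‖p‖^s)| * (‖y‖ * ‖p‖) := by
            congr 2; ring
        _ ≤ (|‖p+x+y‖^s - ‖p‖^s| + 2 * |‖p+y‖^s - ‖p‖^s|) * (‖y‖ * ‖p‖) := by
            gcongr
            refine (abs_sub _ _).trans ?_
            rw [abs_mul, abs_two]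
        _ = (|‖p+x+y‖^s - ‖p‖^s| * ‖p‖ + 2 * (|‖p+y‖^s - ‖p‖^s| * ‖p‖)) * ‖y‖ := by ring
        _ ≤ (C2 * (‖p‖^s * (‖x‖+‖y‖)) + 2 * (C2 * (‖p‖^s * ‖y‖))) * ‖y‖ := by
            have f3 : C2 * (‖p‖^s * ‖x+y‖) ≤ C2 * (‖p‖^s * (‖x‖+‖y‖)) := by
              gcongr
              exact norm_add_le _ _
            refine mul_le_mul_of_nonneg_right ?_ hy0
            linarith
        _ = C2 * (‖p‖^s * ((‖x‖ + 3 * ‖y‖) * ‖y‖)) := by ring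
        _ ≤ C2 * (‖p‖^s * (4 * (‖x‖^2 * ‖y‖^2))) := by
            refine mul_le_mul_of_nonneg_left (mul_le_mul_of_nonneg_left ?_ hps.le) hC2.le
            have : ‖x‖ * ‖y‖ ≤ ‖x‖^2 * ‖y‖^2 := by
              gcongr <;> nlinarith
            have : ‖y‖^2 ≤ ‖x‖^2 * ‖y‖^2 := by nlinarith [mul_nonneg (sq_nonneg ‖y‖) (by nlinarith : 0 ≤ ‖x‖^2 - 1)]
            nlinarith
        _ = 4 * C2 * (‖p‖^s * ‖x‖^2 * ‖y‖^2) := by ring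
        _ ≤ 4 * C2 * PhiB s ‖p‖ ‖x‖ ‖y‖ := by gcongr
        _ ≤ _ := by
            gcongr
            linarith
  · push Not at hc
    obtain ⟨M, hM⟩ : ∃ M, M = max ‖x‖ ‖y‖ := ⟨_, rfl⟩
    rw [← hM] at hc
    have hxM : ‖x‖ ≤ M := hM ▸ le_max_left _ _
    have hyM : ‖y‖ ≤ M := hM ▸ le_max_right _ _
    have hM1 : 1 ≤ M := by linarith
    have hfar := PhiB_far (s := s) hp0 hx hy hM
    have n1 : ‖p+x+y‖ ≤ 10 * M := by
      have := norm_add_le (p+x) y; have := norm_add_le p x; linarith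
    have n2 : ‖p+x‖ ≤ 10 * M := by have := norm_add_le p x; linarith
    have n3 : ‖p+y‖ ≤ 10 * M := by have := norm_add_le p y; linarith
    have n4 : ‖p‖ ≤ 10 * M := by linarith
    have bd : ∀ v : E, ‖v‖ ≤ 10 * M → 0 ≤ ‖v‖^s ∧ ‖v‖^s ≤ 10^s * M^s := fun v hv => by
      refine ⟨by positivity, ?_⟩
      rw [← Real.mul_rpow (by norm_num) (by linarith)]
      gcongr
    obtain ⟨b1, c1⟩ := bd _ n1
    obtain ⟨b2, c2⟩ := bd _ n2
    obtain ⟨b3, c3⟩ := bd _ n3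
    obtain ⟨b4, c4⟩ := bd _ n4
    have hMs : M^(s+1) = M^s * M := Real.rpow_add_one (by linarith) _
    have hMs0 : 0 < M^s := by positivity
    have fin : (4 * (10^s * M^s)) * (‖p‖ * (8 * M)) ≤
        (C1 + 4 * C2 + 32 * 10^s) * PhiB s ‖p‖ ‖x‖ ‖y‖ := by
      calc _ = 32 * 10^s * (‖p‖ * M^(s+1)) := by rw [hMs]; ring
        _ ≤ 32 * 10^s * PhiB s ‖p‖ ‖x‖ ‖y‖ := by gcongr
        _ ≤ _ := by gcongr; linarith
    constructor
    · refine le_trans ?_ fin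
      gcongr
      · rw [abs_le]; constructor <;> linarith
      · rw [sq]; gcongr; linarith
    · refine le_trans ?_ fin
      rw [mul_comm ‖y‖]
      gcongr
      · rw [abs_le]; constructor <;> linarith
      · linarith
end
/-- The frequency vector in Euclidean space. -/
def kv (n : Z3) : EuclideanSpace ℝ (Fin 3) := WithLp.toLp 2 (fun i => 2 * Real.pi * (n i : ℝ))

theorem kv_add (m n : Z3) : kv (m + n) = kv m + kv n := by
  ext i; simp [kv]; ring

theorem knorm_eq (n : Z3) : knorm n = ‖kv n‖ := by
  rw [EuclideanSpace.norm_eq, knorm]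
  simp only [kv, Real.norm_eq_abs, sq_abs, mul_pow (2 * Real.pi)]
  rw [← Finset.mul_sum, Real.sqrt_mul (by positivity), Real.sqrt_sq (by positivity)]

theorem knorm_nonneg (n : Z3) : 0 ≤ knorm n := by rw [knorm_eq]; positivity

theorem knorm_add_le (m n : Z3) : knorm (m + n) ≤ knorm m + knorm n := by
  simp only [knorm_eq, kv_add]; exact norm_add_le _ _

theorem knorm_neg (n : Z3) : knorm (-n) = knorm n := by
  simp [knorm]

theorem coord_le_knorm (n : Z3) (j : Fin 3) : |2 * Real.pi * (n j : ℝ)| ≤ knorm n := by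
  rw [knorm_eq]
  have := PiLp.norm_apply_le (kv n) j
  simpa [kv] using this

theorem one_le_knorm {n : Z3} (hn : n ≠ 0) : 1 ≤ knorm n := by
  obtain ⟨j, hj⟩ : ∃ j, n j ≠ 0 := by
    by_contra! h
    exact hn (funext h)
  refine le_trans ?_ (coord_le_knorm n j)
  rw [abs_mul, abs_of_pos (by positivity)]
  have h1 : (1:ℝ) ≤ |(n j : ℝ)| := by exact_mod_cast Int.one_le_abs hj
  nlinarith [Real.pi_gt_three]

theorem knorm_zero : knorm 0 = 0 := by simp [knorm]

theorem summable_knorm_rpow (r : ℝ) (hr : r < -3) : Summable fun n : Z3 => knorm n ^ r := by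
  let b := (EuclideanSpace.basisFun (Fin 3) ℝ).toBasis
  let L : Submodule ℤ (EuclideanSpace ℝ (Fin 3)) := Submodule.span ℤ (Set.range b)
  have hfr : Module.finrank ℤ L = 3 := by
    rw [ZLattice.rank ℝ L]; simp
  have h := ZLattice.summable_norm_rpow L r (by rw [hfr]; exact_mod_cast hr)
  let φ : Z3 → L := fun n => ⟨∑ i, n i • b i, Submodule.sum_mem _ fun i _ =>
    Submodule.smul_mem _ _ (Submodule.subset_span ⟨i, rfl⟩)⟩
  have hφ : ∀ n i, (φ n : EuclideanSpace ℝ (Fin 3)) i = n i := by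
    intro n i
    simp [φ, b, Finset.sum_apply, Pi.single_apply]
  have hinj : Function.Injective φ := by
    intro m n hmn
    funext i
    have := hφ m i
    rw [hmn, hφ n i] at this
    exact Int.cast_injective (α := ℝ) this.symm
  have h2 := (h.comp_injective hinj).mul_left ((2 * Real.pi) ^ r)
  refine h2.congr fun n => ?_
  simp only [Function.comp]
  unfold knorm
  rw [Real.mul_rpow (x := 2 * Real.pi) (by positivity) (by positivity)]
  congr 2
  rw [Submodule.coe_norm, EuclideanSpace.norm_eq]
  simp only [hφ, Real.norm_eq_abs, sq_abs]

open ENNReal in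
theorem tsum_knorm_ne_top (r : ℝ) (hr : r < -3) :
    ∑' n : Z3, ENNReal.ofReal (knorm n ^ r) ≠ ∞ := by
  exact (summable_knorm_rpow r hr).tsum_ofReal_ne_top

/-- Polynomial weight. -/
def wt (n : Z3) : ENNReal := ENNReal.ofReal (1 + knorm n)

theorem wt_ne_top (n : Z3) : wt n ≠ ⊤ := ENNReal.ofReal_ne_top

theorem one_le_wt (n : Z3) : 1 ≤ wt n := by
  rw [wt, ← ENNReal.ofReal_one]
  exact ENNReal.ofReal_le_ofReal (by linarith [knorm_nonneg n])

theorem wt_add_le (m n : Z3) : wt (m + n) ≤ wt m * wt n := by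
  have h1 := knorm_nonneg m
  have h2 := knorm_nonneg n
  rw [wt, wt, wt, ← ENNReal.ofReal_mul (by linarith)]
  apply ENNReal.ofReal_le_ofReal
  nlinarith [knorm_add_le m n]

theorem wt_sub_le (m n : Z3) : wt (m - n) ≤ wt m * wt n := by
  rw [sub_eq_add_neg]
  refine (wt_add_le _ _).trans ?_
  rw [wt, wt, wt, knorm_neg]

/-- Summability of coefficients against every polynomial weight. -/
def Adm (c : Z3 → ℂ) : Prop := ∀ N : ℕ, ∑' n, wt n ^ N * ‖c n‖ₑ ≠ ⊤

theorem Adm.of_rapid {c : Z3 → ℂ} (h : RapidDecay c) : Adm c := by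
  intro N
  obtain ⟨C, hC⟩ := h (N + 4)
  have hs : Summable fun n : Z3 => (Pi.single 0 1 : Z3 → ℝ) n + knorm n ^ (-4 : ℝ) := by
    refine Summable.add ?_ (summable_knorm_rpow _ (by norm_num))
    refine summable_of_hasFiniteSupport ?_
    exact (Set.finite_singleton (0 : Z3)).subset Pi.support_single_subset
  have hs2 := (hs.mul_left C).tsum_ofReal_ne_top
  refine ne_top_of_le_ne_top hs2 (ENNReal.tsum_le_tsum fun n => ?_)
  have hk := knorm_nonneg n
  rw [wt, ← ENNReal.ofReal_pow (by linarith), ← ofReal_norm,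
    ← ENNReal.ofReal_mul (by positivity)]
  apply ENNReal.ofReal_le_ofReal
  have h1 := hC n
  have hC0 : 0 ≤ C := le_trans (by positivity) h1
  have h2 : ((1 + knorm n)^4)⁻¹ ≤ (Pi.single 0 1 : Z3 → ℝ) n + knorm n ^ (-4 : ℝ) := by
    by_cases hn : n = 0
    · subst hn
      simp [knorm_zero]
    · have := one_le_knorm hn
      rw [Pi.single_eq_of_ne hn, zero_add, Real.rpow_neg hk]
      gcongr
      rw [show (4:ℝ) = ((4:ℕ):ℝ) by norm_num, Real.rpow_natCast]
      gcongr
      linarith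
  calc (1 + knorm n)^N * ‖c n‖ = (‖c n‖ * (1+knorm n)^(N+4)) * ((1 + knorm n)^4)⁻¹ := by
        field_simp; ring
    _ ≤ _ := by gcongr

theorem Adm.of_le {c d : Z3 → ℂ} (M : ℕ) (h : ∀ n, ‖d n‖ₑ ≤ wt n ^ M * ‖c n‖ₑ) (hc : Adm c) :
    Adm d := by
  intro N
  refine ne_top_of_le_ne_top (hc (N + M)) (ENNReal.tsum_le_tsum fun n => ?_)
  calc wt n ^ N * ‖d n‖ₑ ≤ wt n ^ N * (wt n ^ M * ‖c n‖ₑ) := by gcongr; exact h n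
    _ = _ := by ring

theorem Adm.mul {c : Z3 → ℂ} {μ : Z3 → ℂ} (M : ℕ) (h : ∀ n, ‖μ n‖ₑ ≤ wt n ^ M) (hc : Adm c) :
    Adm (fun n => μ n * c n) :=
  Adm.of_le M (fun n => by rw [enorm_mul]; gcongr; exact h n) hc

theorem Adm.add {c d : Z3 → ℂ} (hc : Adm c) (hd : Adm d) : Adm (c + d) := by
  intro N
  refine ne_top_of_le_ne_top (ENNReal.add_ne_top.2 ⟨hc N, hd N⟩) ?_
  rw [← ENNReal.tsum_add]
  refine ENNReal.tsum_le_tsum fun n => ?_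
  rw [← mul_add]
  gcongr
  exact enorm_add_le _ _

theorem Adm.sub {c d : Z3 → ℂ} (hc : Adm c) (hd : Adm d) : Adm (c - d) := by
  rw [sub_eq_add_neg]
  exact hc.add (Adm.of_le 0 (fun n => by simp) hd)

theorem Adm.sum3 {c : Fin 3 → Z3 → ℂ} (hc : ∀ j, Adm (c j)) : Adm (fun n => ∑ j, c j n) := by
  have h : (fun n => ∑ j, c j n) = c 0 + c 1 + c 2 := by
    funext n; simp [Fin.sum_univ_three]
  rw [h]
  exact ((hc 0).add (hc 1)).add (hc 2)

theorem Adm.enorm_ne_top {c : Z3 → ℂ} (hc : Adm c) : ∑' n, ‖c n‖ₑ ≠ ⊤ := by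
  simpa using hc 0

theorem Adm.conv {c d : Z3 → ℂ} (hc : Adm c) (hd : Adm d) : Adm (conv c d) := by
  intro N
  refine ne_top_of_le_ne_top (ENNReal.mul_ne_top (hc N) (hd N)) ?_
  calc ∑' n, wt n ^ N * ‖_root_.conv c d n‖ₑ
      ≤ ∑' n, ∑' m, (wt m ^ N * ‖c m‖ₑ) * (wt (n - m) ^ N * ‖d (n - m)‖ₑ) := by
        refine ENNReal.tsum_le_tsum fun n => ?_
        refine (mul_le_mul_right (enorm_tsum_le_tsum_enorm) _).trans ?_
        rw [← ENNReal.tsum_mul_left]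
        refine ENNReal.tsum_le_tsum fun m => ?_
        have : wt n ≤ wt m * wt (n - m) := by
          simpa using wt_add_le m (n - m)
        calc wt n ^ N * ‖c m * d (n - m)‖ₑ ≤ (wt m * wt (n - m)) ^ N * (‖c m‖ₑ * ‖d (n-m)‖ₑ) := by
              rw [enorm_mul]; gcongr
          _ = _ := by ring
    _ = ∑' m, ∑' n, (wt m ^ N * ‖c m‖ₑ) * (wt (n - m) ^ N * ‖d (n - m)‖ₑ) := ENNReal.tsum_comm
    _ = ∑' m, (wt m ^ N * ‖c m‖ₑ) * ∑' n, (wt n ^ N * ‖d n‖ₑ) := by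
        congr 1; funext m
        rw [ENNReal.tsum_mul_left]
        congr 1
        exact (Equiv.subRight m).tsum_eq (fun n => wt n ^ N * ‖d n‖ₑ)
    _ = _ := ENNReal.tsum_mul_right
    _ ≤ _ := le_rfl

theorem summable_conv {c d : Z3 → ℂ} (hc : Adm c) (hd : Adm d) (n : Z3) :
    Summable fun m => c m * d (n - m) := by
  apply Summable.of_enorm
  refine ne_top_of_le_ne_top (ENNReal.mul_ne_top hc.enorm_ne_top hd.enorm_ne_top) ?_
  rw [← ENNReal.tsum_mul_right]
  refine ENNReal.tsum_le_tsum fun m => ?_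
  rw [enorm_mul]
  gcongr
  exact ENNReal.le_tsum (f := fun k => ‖d k‖ₑ) (n - m)

theorem enorm_pd_symbol (j : Fin 3) (n : Z3) :
    ‖Complex.I * Complex.ofReal (2 * Real.pi * (n j : ℝ))‖ₑ ≤ wt n := by
  rw [← ofReal_norm, wt]
  apply ENNReal.ofReal_le_ofReal
  rw [norm_mul, Complex.norm_I, one_mul, Complex.norm_real, Real.norm_eq_abs]
  linarith [coord_le_knorm n j]

theorem Adm.pd {c : Z3 → ℂ} (hc : Adm c) (j : Fin 3) : Adm (pd j c) :=
  Adm.mul 1 (fun n => by simpa using enorm_pd_symbol j n) hc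

theorem Adm.transport {b : Fin 3 → Z3 → ℂ} {c : Z3 → ℂ} (hb : ∀ j, Adm (b j)) (hc : Adm c) :
    Adm (transport b c) :=
  Adm.sum3 fun j => (hb j).conv (hc.pd j)

theorem enorm_lam_symbol (s : ℝ) (hs : 0 ≤ s) (n : Z3) :
    ‖Complex.ofReal (knorm n ^ s)‖ₑ ≤ wt n ^ ⌈s⌉₊ := by
  have hk := knorm_nonneg n
  rw [← ofReal_norm, wt, ← ENNReal.ofReal_pow (by linarith)]
  apply ENNReal.ofReal_le_ofReal
  rw [Complex.norm_real, Real.norm_eq_abs, abs_of_nonneg (by positivity), ← Real.rpow_natCast]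
  calc knorm n ^ s ≤ (1 + knorm n) ^ s := by gcongr; linarith
    _ ≤ _ := Real.rpow_le_rpow_of_exponent_le (by linarith) (Nat.le_ceil s)

theorem Adm.lam {c : Z3 → ℂ} {s : ℝ} (hs : 0 ≤ s) (hc : Adm c) : Adm (lam s c) :=
  Adm.mul _ (enorm_lam_symbol s hs) hc

/-- The symbol `b̂(m)·(iq)`. -/
def Bsym (b : Fin 3 → Z3 → ℂ) (m q : Z3) : ℂ :=
  ∑ j, b j m * (Complex.I * Complex.ofReal (2 * Real.pi * (q j : ℝ)))

theorem Bsym_add (b : Fin 3 → Z3 → ℂ) (m q r : Z3) :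
    Bsym b m (q + r) = Bsym b m q + Bsym b m r := by
  simp only [Bsym, ← Finset.sum_add_distrib]
  refine Finset.sum_congr rfl fun j _ => ?_
  simp; ring

/-- Sum of the sizes of components. -/
def bn (b : Fin 3 → Z3 → ℂ) (m : Z3) : ℝ := ∑ j, ‖b j m‖

theorem bn_nonneg (b : Fin 3 → Z3 → ℂ) (m : Z3) : 0 ≤ bn b m := by unfold bn; positivity

theorem norm_Bsym_le (b : Fin 3 → Z3 → ℂ) (m q : Z3) : ‖Bsym b m q‖ ≤ bn b m * knorm q := by
  rw [Bsym, bn, Finset.sum_mul]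
  refine (norm_sum_le _ _).trans (Finset.sum_le_sum fun j _ => ?_)
  rw [norm_mul, norm_mul, Complex.norm_I, one_mul, Complex.norm_real, Real.norm_eq_abs]
  gcongr
  exact coord_le_knorm q j

theorem enorm_Bsym_le (b : Fin 3 → Z3 → ℂ) (m q : Z3) :
    ‖Bsym b m q‖ₑ ≤ ENNReal.ofReal (bn b m) * wt q := by
  rw [← ofReal_norm, wt, ← ENNReal.ofReal_mul (bn_nonneg b m)]
  apply ENNReal.ofReal_le_ofReal
  refine (norm_Bsym_le b m q).trans ?_
  have := bn_nonneg b m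
  gcongr
  linarith

theorem ofReal_bn (b : Fin 3 → Z3 → ℂ) (m : Z3) : ENNReal.ofReal (bn b m) = ∑ j, ‖b j m‖ₑ := by
  rw [bn, ENNReal.ofReal_sum_of_nonneg (fun _ _ => norm_nonneg _)]
  simp [ofReal_norm]

theorem tsum_bn_ne_top {b : Fin 3 → Z3 → ℂ} (hb : ∀ j, Adm (b j)) (N : ℕ) :
    ∑' m, wt m ^ N * ENNReal.ofReal (bn b m) ≠ ⊤ := by
  have : ∀ m, wt m ^ N * ENNReal.ofReal (bn b m) =
      wt m ^ N * ‖b 0 m‖ₑ + wt m ^ N * ‖b 1 m‖ₑ + wt m ^ N * ‖b 2 m‖ₑ := by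
    intro m; rw [ofReal_bn, Fin.sum_univ_three]; ring
  simp only [this, ENNReal.tsum_add]
  exact ENNReal.add_ne_top.2 ⟨ENNReal.add_ne_top.2 ⟨hb 0 N, hb 1 N⟩, hb 2 N⟩

theorem transport_eq {b : Fin 3 → Z3 → ℂ} {c : Z3 → ℂ} (hb : ∀ j, Adm (b j)) (hc : Adm c)
    (n : Z3) : transport b c n = ∑' m, Bsym b m (n - m) * c (n - m) := by
  unfold transport _root_.conv
  rw [← Summable.tsum_finsetSum fun j _ => summable_conv (hb j) (hc.pd j) n]
  congr 1; funext m
  rw [Bsym, Finset.sum_mul]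
  refine Finset.sum_congr rfl fun j _ => ?_
  simp only [_root_.pd]; ring

theorem transport_sub {b : Fin 3 → Z3 → ℂ} {c d : Z3 → ℂ} (hb : ∀ j, Adm (b j)) (hc : Adm c)
    (hd : Adm d) : transport b (c - d) = transport b c - transport b d := by
  funext n
  simp only [transport, Pi.sub_apply, ← Finset.sum_sub_distrib]
  refine Finset.sum_congr rfl fun j _ => ?_
  unfold _root_.conv
  rw [← Summable.tsum_sub (summable_conv (hb j) (hc.pd j) n) (summable_conv (hb j) (hd.pd j) n)]
  congr 1; funext m
  simp only [_root_.pd, Pi.sub_apply]; ring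

/-- Kernel of the twofold transport. -/
def Hker (b : Fin 3 → Z3 → ℂ) (μ ν f : Z3 → ℂ) (n : Z3) (z : Z3 × Z3) : ℂ :=
  (Bsym b z.1 (n - z.1) * μ (n - z.1)) *
    (Bsym b z.2 (n - z.1 - z.2) * (ν (n - z.1 - z.2) * f (n - z.1 - z.2)))

theorem summable_Hker {b : Fin 3 → Z3 → ℂ} {μ ν f : Z3 → ℂ} (hb : ∀ j, Adm (b j)) (hf : Adm f)
    (M : ℕ) (hμ : ∀ n, ‖μ n‖ₑ ≤ wt n ^ M) (hν : ∀ n, ‖ν n‖ₑ ≤ wt n ^ M) (n : Z3) :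
    Summable (Hker b μ ν f n) := by
  apply Summable.of_enorm
  obtain ⟨S, hS⟩ : ∃ S, S = ∑' k, wt k ^ (M+1) * ‖f k‖ₑ := ⟨_, rfl⟩
  have hfin : (wt n ^ (M+1) * S) * ((∑' m, wt m ^ (M+1) * ENNReal.ofReal (bn b m)) *
      ∑' m, wt m ^ 0 * ENNReal.ofReal (bn b m)) ≠ ⊤ :=
    ENNReal.mul_ne_top (ENNReal.mul_ne_top (ENNReal.pow_ne_top (wt_ne_top n)) (hS ▸ hf _))
      (ENNReal.mul_ne_top (tsum_bn_ne_top hb _) (tsum_bn_ne_top hb _))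
  refine ne_top_of_le_ne_top hfin ?_
  rw [← ENNReal.tsum_mul_right, ← ENNReal.tsum_mul_left, ENNReal.tsum_prod']
  refine ENNReal.tsum_le_tsum fun x => ?_
  rw [← ENNReal.tsum_mul_left, ← ENNReal.tsum_mul_left]
  refine ENNReal.tsum_le_tsum fun y => ?_
  simp only [Hker, enorm_mul]
  have h1 : wt (n - x - y) ^ (M+1) * ‖f (n - x - y)‖ₑ ≤ S := hS ▸
    ENNReal.le_tsum (f := fun k => wt k ^ (M+1) * ‖f k‖ₑ) (n - x - y)
  calc _ ≤ ((ENNReal.ofReal (bn b x) * wt (n - x)) * wt (n - x) ^ M) *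
      ((ENNReal.ofReal (bn b y) * wt (n - x - y)) * (wt (n-x-y) ^ M * ‖f (n - x - y)‖ₑ)) := by
        gcongr
        · exact enorm_Bsym_le b _ _
        · exact hμ _
        · exact enorm_Bsym_le b _ _
        · exact hν _
    _ = (ENNReal.ofReal (bn b x) * wt (n - x) ^ (M+1)) * (ENNReal.ofReal (bn b y) *
         (wt (n-x-y) ^ (M+1) * ‖f (n - x - y)‖ₑ)) := by ring
    _ ≤ (ENNReal.ofReal (bn b x) * (wt n * wt x) ^ (M+1)) * (ENNReal.ofReal (bn b y) * S) := by
        gcongr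
        exact wt_sub_le n x
    _ = _ := by ring

theorem transport_transport {b : Fin 3 → Z3 → ℂ} {μ ν f : Z3 → ℂ} (hb : ∀ j, Adm (b j))
    (hf : Adm f) (M : ℕ) (hμ : ∀ n, ‖μ n‖ₑ ≤ wt n ^ M) (hν : ∀ n, ‖ν n‖ₑ ≤ wt n ^ M) (n : Z3) :
    transport b (fun k => μ k * transport b (fun l => ν l * f l) k) n =
      ∑' z, Hker b μ ν f n z := by
  have h1 : Adm (fun l => ν l * f l) := hf.mul M hν
  have h2 : Adm (transport b (fun l => ν l * f l)) := h1.transport hb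
  rw [transport_eq hb (h2.mul M hμ), (summable_Hker hb hf M hμ hν n).tsum_prod]
  congr 1; funext x
  rw [transport_eq hb h1, ← mul_assoc, ← tsum_mul_left]
  rfl
theorem ennreal_two_mul_le (a b : ENNReal) : 2 * a * b ≤ a ^ 2 + b ^ 2 := by
  rcases le_total a b with h | h
  · obtain ⟨c, rfl⟩ := exists_add_of_le h
    calc 2 * a * (a + c) ≤ 2 * a * (a + c) + c ^ 2 := le_self_add
      _ = _ := by ring
  · obtain ⟨c, rfl⟩ := exists_add_of_le h
    calc 2 * (b + c) * b ≤ 2 * (b + c) * b + c ^ 2 := le_self_add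
      _ = _ := by ring

theorem tsum_CS {ι : Type*} (u v : ι → ENNReal) :
    (∑' i, u i * v i) ^ 2 ≤ (∑' i, u i ^ 2) * ∑' i, v i ^ 2 := by
  have h2 : 2 * (∑' i, u i * v i) ^ 2 ≤ 2 * ((∑' i, u i ^ 2) * ∑' i, v i ^ 2) := by
    calc 2 * (∑' i, u i * v i) ^ 2 = ∑' i, ∑' j, 2 * ((u i * v j) * (u j * v i)) := by
          rw [sq, ← ENNReal.tsum_mul_right, ← ENNReal.tsum_mul_left]
          congr 1; funext i
          rw [← ENNReal.tsum_mul_left, ← ENNReal.tsum_mul_left]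
          congr 1; funext j; ring
      _ ≤ ∑' i, ∑' j, (u i ^ 2 * v j ^ 2 + v i ^ 2 * u j ^ 2) := by
          refine ENNReal.tsum_le_tsum fun i => ENNReal.tsum_le_tsum fun j => ?_
          have := ennreal_two_mul_le (u i * v j) (u j * v i)
          calc _ = 2 * (u i * v j) * (u j * v i) := by ring
            _ ≤ _ := this
            _ = _ := by ring
      _ = _ := by
          simp only [ENNReal.tsum_add, ENNReal.tsum_mul_left, ENNReal.tsum_mul_right]
          ring
  exact (ENNReal.mul_le_mul_iff_right (by norm_num) (by norm_num)).1 h2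

theorem tsum_CS' {ι : Type*} (u v : ι → ENNReal) :
    (∑' i, u i * v i) ^ 2 ≤ (∑' i, u i) * ∑' i, u i * v i ^ 2 := by
  have h2 : 2 * (∑' i, u i * v i) ^ 2 ≤ 2 * ((∑' i, u i) * ∑' i, u i * v i ^ 2) := by
    calc 2 * (∑' i, u i * v i) ^ 2 = ∑' i, ∑' j, (u i * u j) * (2 * v i * v j) := by
          rw [sq, ← ENNReal.tsum_mul_right, ← ENNReal.tsum_mul_left]
          congr 1; funext i
          rw [← ENNReal.tsum_mul_left, ← ENNReal.tsum_mul_left]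
          congr 1; funext j; ring
      _ ≤ ∑' i, ∑' j, (u i * (u j * v j ^ 2) + (u i * v i ^ 2) * u j) := by
          refine ENNReal.tsum_le_tsum fun i => ENNReal.tsum_le_tsum fun j => ?_
          calc (u i * u j) * (2 * v i * v j) ≤ (u i * u j) * (v i ^ 2 + v j ^ 2) := by
                gcongr; exact ennreal_two_mul_le _ _
            _ = _ := by ring
      _ = _ := by
          simp only [ENNReal.tsum_add, ENNReal.tsum_mul_left, ENNReal.tsum_mul_right]
          ring
  exact (ENNReal.mul_le_mul_iff_right (by norm_num) (by norm_num)).1 h2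

theorem young {ι : Type*} (U : ι → ENNReal) (τ : ι → Z3) (w : Z3 → ENNReal) :
    ∑' n, (∑' i, U i * w (n - τ i)) ^ 2 ≤ (∑' i, U i) ^ 2 * ∑' n, w n ^ 2 := by
  calc ∑' n, (∑' i, U i * w (n - τ i)) ^ 2
      ≤ ∑' n, (∑' i, U i) * ∑' i, U i * w (n - τ i) ^ 2 :=
        ENNReal.tsum_le_tsum fun n => tsum_CS' _ _
    _ = (∑' i, U i) * ∑' i, ∑' n, U i * w (n - τ i) ^ 2 := by
        rw [ENNReal.tsum_mul_left, ENNReal.tsum_comm]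
    _ = (∑' i, U i) * ∑' i, U i * ∑' n, w n ^ 2 := by
        congr 2; funext i
        rw [ENNReal.tsum_mul_left]
        congr 1
        exact (Equiv.subRight (τ i)).tsum_eq (fun n => w n ^ 2)
    _ = _ := by rw [ENNReal.tsum_mul_right]; ring

theorem tsum_prod_mul (u v : Z3 → ENNReal) :
    ∑' z : Z3 × Z3, u z.1 * v z.2 = (∑' x, u x) * ∑' y, v y := by
  rw [ENNReal.tsum_prod']
  simp only [ENNReal.tsum_mul_left, ENNReal.tsum_mul_right]

/-- Triple convolution. -/
def tri (u v w : Z3 → ENNReal) (n : Z3) : ENNReal :=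
  ∑' z : Z3 × Z3, u z.1 * v z.2 * w (n - z.1 - z.2)

theorem tri_young (u v w : Z3 → ENNReal) :
    ∑' n, tri u v w n ^ 2 ≤ (∑' x, u x) ^ 2 * (∑' x, v x) ^ 2 * ∑' x, w x ^ 2 := by
  have := young (fun z : Z3 × Z3 => u z.1 * v z.2) (fun z => z.1 + z.2) w
  rw [tsum_prod_mul, mul_pow] at this
  simpa only [tri, sub_sub] using this

theorem tri_swap (u v w : Z3 → ENNReal) (n : Z3) : tri u v w n = tri v u w n := by
  unfold tri
  rw [← (Equiv.prodComm Z3 Z3).tsum_eq]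
  congr 1; funext z
  simp only [Equiv.prodComm_apply, Prod.fst_swap, Prod.snd_swap]
  rw [sub_right_comm]; ring

theorem tri_rot (u v w : Z3 → ENNReal) (n : Z3) : tri u v w n = tri w v u n := by
  have h : ∀ u w : Z3 → ENNReal, tri u v w n = ∑' y, ∑' x, u x * v y * w (n - x - y) := by
    intro u w
    unfold tri
    rw [ENNReal.tsum_prod', ENNReal.tsum_comm]
  rw [h, h]
  congr 1; funext y
  rw [← (Equiv.subLeft (n - y)).tsum_eq]
  congr 1; funext x
  simp only [Equiv.subLeft_apply]
  rw [show n - (n - y - x) - y = x by abel, show n - x - y = n - y - x by abel]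
  ring

/-- The combined integrand of the double commutator. -/
def Hd (s : ℝ) (b : Fin 3 → Z3 → ℂ) (f : Z3 → ℂ) (n : Z3) (z : Z3 × Z3) : ℂ :=
  (((knorm n ^ s - 2 * knorm (n - z.1) ^ s + knorm (n - z.1 - z.2) ^ s : ℝ)) : ℂ) *
    (Bsym b z.1 (n - z.1) * Bsym b z.2 (n - z.1 - z.2) * f (n - z.1 - z.2))

theorem double_comm_eq {s : ℝ} (hs : 0 ≤ s) {b : Fin 3 → Z3 → ℂ} {f : Z3 → ℂ}
    (hb : ∀ j, Adm (b j)) (hf : Adm f) (n : Z3) :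
    Summable (Hd s b f n) ∧
    (commLam s b (transport b f) - transport b (commLam s b f)) n = ∑' z, Hd s b f n z := by
  set g : Z3 → ℂ := fun n => Complex.ofReal (knorm n ^ s) with hg
  have hgb : ∀ n, ‖g n‖ₑ ≤ wt n ^ ⌈s⌉₊ := enorm_lam_symbol s hs
  have h1b : ∀ n : Z3, ‖(fun _ => 1 : Z3 → ℂ) n‖ₑ ≤ wt n ^ ⌈s⌉₊ := fun n => by
    simpa using one_le_pow₀ (one_le_wt n)
  have S0 := summable_Hker (μ := fun _ => 1) (ν := fun _ => 1) hb hf _ h1b h1b n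
  have S1 := summable_Hker (μ := g) (ν := fun _ => 1) hb hf _ hgb h1b n
  have S2 := summable_Hker (μ := fun _ => 1) (ν := g) hb hf _ h1b hgb n
  have E0 := transport_transport (μ := fun _ => 1) (ν := fun _ => 1) hb hf _ h1b h1b n
  have E1 := transport_transport (μ := g) (ν := fun _ => 1) hb hf _ hgb h1b n
  have E2 := transport_transport (μ := fun _ => 1) (ν := g) hb hf _ h1b hgb n
  simp only [one_mul] at E0 E1 E2
  have hH : ∀ z, Hd s b f n z = g n * Hker b (fun _ => 1) (fun _ => 1) f n z
      - 2 * Hker b g (fun _ => 1) f n z + Hker b (fun _ => 1) g f n z := by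
    intro z
    simp only [Hd, Hker, hg]
    push_cast
    ring
  have hS : HasSum (Hd s b f n) (g n * ∑' z, Hker b (fun _ => 1) (fun _ => 1) f n z
      - 2 * ∑' z, Hker b g (fun _ => 1) f n z + ∑' z, Hker b (fun _ => 1) g f n z) := by
    rw [funext hH]
    exact ((S0.hasSum.mul_left _).sub (S1.hasSum.mul_left _)).add S2.hasSum
  refine ⟨hS.summable, ?_⟩
  rw [hS.tsum_eq, ← E0, ← E1, ← E2]
  have hT := hf.transport hb
  have hc : commLam s b f = lam s (transport b f) - transport b (lam s f) := rfl
  rw [hc, transport_sub hb (hT.lam hs) ((hf.lam hs).transport hb)]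
  simp only [commLam, Pi.sub_apply]
  change g n * transport b (transport b f) n - transport b (lam s (transport b f)) n -
    (transport b (lam s (transport b f)) n - transport b (transport b (lam s f)) n) =
    g n * transport b (transport b f) n - 2 * transport b (lam s (transport b f)) n
      + transport b (transport b (lam s f)) n
  ring

theorem Hd_sym_bound {s : ℝ} {C : ℝ}
    (hC : 0 < C) (hsymb : ∀ p x y : EuclideanSpace ℝ (Fin 3), 1 ≤ ‖x‖ → 1 ≤ ‖y‖ →
    |‖p+x+y‖^s - ‖p+x‖^s - ‖p+y‖^s + ‖p‖^s| * ‖p‖^2 ≤ C * PhiB s ‖p‖ ‖x‖ ‖y‖ ∧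
    |‖p+x+y‖^s - 2 * ‖p+y‖^s + ‖p‖^s| * (‖y‖ * ‖p‖) ≤ C * PhiB s ‖p‖ ‖x‖ ‖y‖)
    {b : Fin 3 → Z3 → ℂ} {f : Z3 → ℂ} (hb0 : ∀ j, b j 0 = 0) (n x y : Z3) :
    ‖Hd s b f n (x, y) + Hd s b f n (y, x)‖ ≤
      4 * C * (bn b x * bn b y * ‖f (n - x - y)‖ *
        PhiB s (knorm (n - x - y)) (knorm x) (knorm y)) := by
  have hPhi := PhiB_nonneg s (knorm (n-x-y)) (knorm x) (knorm y) (knorm_nonneg _) (knorm_nonneg _)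
    (knorm_nonneg _)
  have hbx := bn_nonneg b x
  have hby := bn_nonneg b y
  have hB0 : ∀ q, Bsym b 0 q = 0 := fun q => by simp [Bsym, hb0]
  by_cases hx : x = 0
  · subst hx
    simp only [Hd, hB0]
    simp only [zero_mul, mul_zero, add_zero, norm_zero]
    positivity
  by_cases hy : y = 0
  · subst hy
    simp only [Hd, hB0]
    simp only [zero_mul, mul_zero, add_zero, norm_zero]
    positivity
  obtain ⟨p, hp⟩ : ∃ p, p = n - x - y := ⟨_, rfl⟩
  have hn : n = p + x + y := by rw [hp]; abel
  have e1 : n - x = p + y := by rw [hn]; abel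
  have e2 : n - y = p + x := by rw [hn]; abel
  have e3 : p + y - y = p := by abel
  have e4 : p + x - x = p := by abel
  rw [← hp] at hPhi ⊢
  simp only [Hd, e1, e2, e3, e4, Bsym_add]
  rw [hn]
  have hx1 := one_le_knorm hx
  have hy1 := one_le_knorm hy
  have key := hsymb (kv p) (kv x) (kv y)
  have key' := hsymb (kv p) (kv y) (kv x)
  rw [show kv p + kv y + kv x = kv p + kv x + kv y by abel] at key'
  simp only [← kv_add, ← knorm_eq] at key key'
  obtain ⟨k1, k2⟩ := key hx1 hy1
  obtain ⟨-, k3⟩ := key' hy1 hx1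
  rw [PhiB_swap] at k3
  set Φ := PhiB s (knorm p) (knorm x) (knorm y)
  set d0 : ℝ := knorm (p+x+y)^s - knorm (p+x)^s - knorm (p+y)^s + knorm p^s
  set d1 : ℝ := knorm (p+x+y)^s - 2 * knorm (p+y)^s + knorm p^s with hd1
  set d2 : ℝ := knorm (p+x+y)^s - 2 * knorm (p+x)^s + knorm p^s with hd2
  have hd : d1 + d2 = 2 * d0 := by simp only [d0, d1, d2]; ring
  have hd' : (d1 : ℂ) + (d2 : ℂ) = 2 * (d0 : ℂ) := by exact_mod_cast hd
  have split : (d1:ℂ) * ((Bsym b x p + Bsym b x y) * Bsym b y p * f p) +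
      (d2:ℂ) * ((Bsym b y p + Bsym b y x) * Bsym b x p * f p) =
      2 * (d0:ℂ) * (Bsym b x p * Bsym b y p * f p) + (d1:ℂ) * (Bsym b x y * Bsym b y p * f p)
        + (d2:ℂ) * (Bsym b y x * Bsym b x p * f p) := by
    rw [← hd']; ring
  rw [split]
  have hF := norm_nonneg (f p)
  have hkp := knorm_nonneg p
  have hkx := knorm_nonneg x
  have hky := knorm_nonneg y
  refine (norm_add₃_le).trans ?_
  have t1 : ‖2 * (d0:ℂ) * (Bsym b x p * Bsym b y p * f p)‖ ≤
      2 * C * (bn b x * bn b y * ‖f p‖ * Φ) := by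
    simp only [norm_mul, Complex.norm_real, Real.norm_eq_abs, Complex.norm_ofNat]
    calc _ ≤ 2 * |d0| * ((bn b x * knorm p) * (bn b y * knorm p) * ‖f p‖) := by
          gcongr <;> exact norm_Bsym_le _ _ _
      _ = 2 * (bn b x * bn b y * ‖f p‖) * (|d0| * knorm p ^ 2) := by ring
      _ ≤ 2 * (bn b x * bn b y * ‖f p‖) * (C * Φ) := by gcongr
      _ = _ := by ring
  have t2 : ‖(d1:ℂ) * (Bsym b x y * Bsym b y p * f p)‖ ≤
      C * (bn b x * bn b y * ‖f p‖ * Φ) := by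
    simp only [norm_mul, Complex.norm_real, Real.norm_eq_abs]
    calc _ ≤ |d1| * ((bn b x * knorm y) * (bn b y * knorm p) * ‖f p‖) := by
          gcongr <;> exact norm_Bsym_le _ _ _
      _ = (bn b x * bn b y * ‖f p‖) * (|d1| * (knorm y * knorm p)) := by ring
      _ ≤ (bn b x * bn b y * ‖f p‖) * (C * Φ) := by gcongr
      _ = _ := by ring
  have t3 : ‖(d2:ℂ) * (Bsym b y x * Bsym b x p * f p)‖ ≤
      C * (bn b x * bn b y * ‖f p‖ * Φ) := by
    simp only [norm_mul, Complex.norm_real, Real.norm_eq_abs]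
    calc _ ≤ |d2| * ((bn b y * knorm x) * (bn b x * knorm p) * ‖f p‖) := by
          gcongr <;> exact norm_Bsym_le _ _ _
      _ = (bn b x * bn b y * ‖f p‖) * (|d2| * (knorm x * knorm p)) := by ring
      _ ≤ (bn b x * bn b y * ‖f p‖) * (C * Φ) := by gcongr
      _ = _ := by ring
  linarith

/-- `|f̂|` weighted. -/
def wf (t : ℝ) (F : Z3 → ℝ) (n : Z3) : ENNReal := ENNReal.ofReal (knorm n ^ t * F n)

theorem double_comm_bound {s : ℝ} (hs : 0 ≤ s) {C : ℝ}
    (hC : 0 < C) (hsymb : ∀ p x y : EuclideanSpace ℝ (Fin 3), 1 ≤ ‖x‖ → 1 ≤ ‖y‖ →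
    |‖p+x+y‖^s - ‖p+x‖^s - ‖p+y‖^s + ‖p‖^s| * ‖p‖^2 ≤ C * PhiB s ‖p‖ ‖x‖ ‖y‖ ∧
    |‖p+x+y‖^s - 2 * ‖p+y‖^s + ‖p‖^s| * (‖y‖ * ‖p‖) ≤ C * PhiB s ‖p‖ ‖x‖ ‖y‖)
    {b : Fin 3 → Z3 → ℂ} {f : Z3 → ℂ} (hb : ∀ j, Adm (b j)) (hf : Adm f)
    (hb0 : ∀ j, b j 0 = 0) (n : Z3) :
    ‖(commLam s b (transport b f) - transport b (commLam s b f)) n‖ₑ ≤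
      ENNReal.ofReal (4 * C) * (
        tri (wf 2 (bn b)) (wf 2 (bn b)) (wf s (fun k => ‖f k‖)) n +
        tri (wf (s+1) (bn b)) (wf 2 (bn b)) (wf 1 (fun k => ‖f k‖)) n +
        tri (wf 2 (bn b)) (wf (s+1) (bn b)) (wf 1 (fun k => ‖f k‖)) n) := by
  obtain ⟨hS, hE⟩ := double_comm_eq hs hb hf n
  have h2 : (2:ℂ) * (commLam s b (transport b f) - transport b (commLam s b f)) n =
      ∑' z : Z3 × Z3, (Hd s b f n z + Hd s b f n z.swap) := by
    have hS' : Summable fun z : Z3 × Z3 => Hd s b f n z.swap :=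
      (Equiv.prodComm Z3 Z3).summable_iff.2 hS
    rw [Summable.tsum_add hS hS', hE, two_mul]
    congr 1
    exact ((Equiv.prodComm Z3 Z3).tsum_eq (Hd s b f n)).symm
  have h1 : ‖(commLam s b (transport b f) - transport b (commLam s b f)) n‖ₑ ≤
      ‖(2:ℂ) * (commLam s b (transport b f) - transport b (commLam s b f)) n‖ₑ := by
    rw [← ofReal_norm, ← ofReal_norm]
    apply ENNReal.ofReal_le_ofReal
    rw [norm_mul, Complex.norm_ofNat]
    nlinarith [norm_nonneg ((commLam s b (transport b f) - transport b (commLam s b f)) n)]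
  refine h1.trans ?_
  rw [h2]
  refine enorm_tsum_le_tsum_enorm.trans ?_
  unfold tri
  rw [← ENNReal.tsum_add, ← ENNReal.tsum_add, ← ENNReal.tsum_mul_left]
  refine ENNReal.tsum_le_tsum fun z => ?_
  obtain ⟨x, y⟩ := z
  rw [← ofReal_norm]
  refine (ENNReal.ofReal_le_ofReal (Hd_sym_bound hC hsymb hb0 n x y)).trans (le_of_eq ?_)
  have hbx := bn_nonneg b x
  have hby := bn_nonneg b y
  have hkp := knorm_nonneg (n - x - y)
  have hkx := knorm_nonneg x
  have hky := knorm_nonneg y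
  simp only [wf]
  rw [← ENNReal.ofReal_mul (by positivity), ← ENNReal.ofReal_mul (by positivity),
    ← ENNReal.ofReal_mul (by positivity), ← ENNReal.ofReal_mul (by positivity),
    ← ENNReal.ofReal_mul (by positivity), ← ENNReal.ofReal_mul (by positivity),
    ← ENNReal.ofReal_add (by positivity) (by positivity),
    ← ENNReal.ofReal_add (by positivity) (by positivity), ← ENNReal.ofReal_mul (by positivity)]
  congr 1
  unfold PhiB
  rw [Real.rpow_two, Real.rpow_two, Real.rpow_one]
  ring

theorem wf_l1 {s t t' : ℝ} (F : Z3 → ℝ) (hF : ∀ n, 0 ≤ F n) (ht : t = t' + (1 - s)) (ht0 : t ≠ 0) :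
    (∑' n, wf t F n) ^ 2 ≤ (∑' n : Z3, ENNReal.ofReal (knorm n ^ (2 - 2 * s))) *
      ∑' n, wf t' F n ^ 2 := by
  have : ∀ n, wf t F n ≤ ENNReal.ofReal (knorm n ^ (1 - s)) * wf t' F n := by
    intro n
    have hk := knorm_nonneg n
    rw [wf, wf, ← ENNReal.ofReal_mul (by positivity)]
    apply ENNReal.ofReal_le_ofReal
    rcases hk.eq_or_lt with h | h
    · rw [← h, Real.zero_rpow ht0, zero_mul]
      have := hF n
      positivity
    · rw [ht, Real.rpow_add h]
      apply le_of_eq; ring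
  calc (∑' n, wf t F n) ^ 2 ≤ (∑' n, ENNReal.ofReal (knorm n ^ (1 - s)) * wf t' F n) ^ 2 := by
        gcongr with n; exact this n
    _ ≤ _ := tsum_CS _ _
    _ = _ := by
        congr 2; funext n
        have hk := knorm_nonneg n
        rw [← ENNReal.ofReal_pow (by positivity), ← Real.rpow_natCast, ← Real.rpow_mul hk]
        congr 2; push_cast; ring

theorem add3_sq (a b c : ENNReal) : (a + b + c) ^ 2 ≤ 3 * (a ^ 2 + b ^ 2 + c ^ 2) := by
  have h1 := ennreal_two_mul_le a b
  have h2 := ennreal_two_mul_le a c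
  have h3 := ennreal_two_mul_le b c
  calc (a + b + c) ^ 2 = (a^2 + b^2 + c^2) + (2*a*b + 2*a*c + 2*b*c) := by ring
    _ ≤ (a^2 + b^2 + c^2) + ((a^2+b^2) + (a^2+c^2) + (b^2+c^2)) := by gcongr
    _ = _ := by ring

theorem main_ennreal {s : ℝ} (hs : 5/2 < s) : ∃ K : ENNReal, K ≠ ⊤ ∧
    ∀ (b : Fin 3 → Z3 → ℂ) (f : Z3 → ℂ), (∀ j, Adm (b j)) → Adm f → (∀ j, b j 0 = 0) →
    ∑' n, ‖(commLam s b (transport b f) - transport b (commLam s b f)) n‖ₑ ^ 2 ≤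
      K * (∑' n, wf (s+1) (bn b) n ^ 2) ^ 2 * ∑' n, wf s (fun k => ‖f k‖) n ^ 2 := by
  obtain ⟨C, hC, hsymb⟩ := symb1 (E := EuclideanSpace ℝ (Fin 3)) s hs
  obtain ⟨L, hL⟩ : ∃ L, L = ∑' n : Z3, ENNReal.ofReal (knorm n ^ (2 - 2 * s)) := ⟨_, rfl⟩
  have hLt : L ≠ ⊤ := hL ▸ tsum_knorm_ne_top _ (by linarith)
  refine ⟨ENNReal.ofReal (4 * C) ^ 2 * (3 * (3 * L ^ 2)), ?_, ?_⟩
  · refine ENNReal.mul_ne_top (ENNReal.pow_ne_top ENNReal.ofReal_ne_top) ?_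
    refine ENNReal.mul_ne_top (by norm_num) (ENNReal.mul_ne_top (by norm_num) ?_)
    exact ENNReal.pow_ne_top hLt
  intro b f hb hf hb0
  obtain ⟨Y, hY⟩ : ∃ Y, Y = ∑' n, wf (s+1) (bn b) n ^ 2 := ⟨_, rfl⟩
  obtain ⟨X, hX⟩ : ∃ X, X = ∑' n, wf s (fun k => ‖f k‖) n ^ 2 := ⟨_, rfl⟩
  have l1b : (∑' n, wf 2 (bn b) n) ^ 2 ≤ L * Y := by
    rw [hL, hY]; exact wf_l1 _ (bn_nonneg b) (by ring) (by norm_num)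
  have l1f : (∑' n, wf 1 (fun k => ‖f k‖) n) ^ 2 ≤ L * X := by
    rw [hL, hX]; exact wf_l1 _ (fun _ => norm_nonneg _) (by ring) (by norm_num)
  have T1 := tri_young (wf 2 (bn b)) (wf 2 (bn b)) (wf s (fun k => ‖f k‖))
  have T2 := tri_young (wf 1 (fun k => ‖f k‖)) (wf 2 (bn b)) (wf (s+1) (bn b))
  rw [← hX] at T1
  rw [← hY] at T2
  have T1' : ∑' n, tri (wf 2 (bn b)) (wf 2 (bn b)) (wf s (fun k => ‖f k‖)) n ^ 2 ≤
      L ^ 2 * Y ^ 2 * X := by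
    refine T1.trans ?_
    calc _ ≤ (L * Y) * (L * Y) * X := by gcongr
      _ = _ := by ring
  have T2' : ∑' n, tri (wf (s+1) (bn b)) (wf 2 (bn b)) (wf 1 (fun k => ‖f k‖)) n ^ 2 ≤
      L ^ 2 * Y ^ 2 * X := by
    simp only [tri_rot (wf (s+1) (bn b))]
    refine T2.trans ?_
    calc _ ≤ (L * X) * (L * Y) * Y := by gcongr
      _ = _ := by ring
  have T3' : ∑' n, tri (wf 2 (bn b)) (wf (s+1) (bn b)) (wf 1 (fun k => ‖f k‖)) n ^ 2 ≤
      L ^ 2 * Y ^ 2 * X := by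
    simp only [tri_swap (wf 2 (bn b)) (wf (s+1) (bn b))]
    exact T2'
  rw [← hX, ← hY]
  calc _ ≤ ∑' n, ENNReal.ofReal (4 * C) ^ 2 * (3 * (
        tri (wf 2 (bn b)) (wf 2 (bn b)) (wf s (fun k => ‖f k‖)) n ^ 2 +
        tri (wf (s+1) (bn b)) (wf 2 (bn b)) (wf 1 (fun k => ‖f k‖)) n ^ 2 +
        tri (wf 2 (bn b)) (wf (s+1) (bn b)) (wf 1 (fun k => ‖f k‖)) n ^ 2)) := by
        refine ENNReal.tsum_le_tsum fun n => ?_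
        refine (pow_le_pow_left' (double_comm_bound (by linarith) hC hsymb hb hf hb0 n) 2).trans ?_
        rw [mul_pow]
        gcongr
        exact add3_sq _ _ _
    _ ≤ ENNReal.ofReal (4 * C) ^ 2 * (3 * (L ^ 2 * Y ^ 2 * X + L ^ 2 * Y ^ 2 * X
          + L ^ 2 * Y ^ 2 * X)) := by
        rw [ENNReal.tsum_mul_left, ENNReal.tsum_mul_left, ENNReal.tsum_add, ENNReal.tsum_add]
        gcongr
    _ = _ := by ring

theorem hnorm_sq {σ : ℝ} (hσ : 0 ≤ σ) {c : Z3 → ℂ} (hc : Adm c) :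
    ENNReal.ofReal (hnorm σ c ^ 2) =
      ∑' n, ENNReal.ofReal ((1 + knorm n ^ (2 * σ)) * ‖c n‖ ^ 2) ∧ 
    ∑' n, wf σ (fun k => ‖c k‖) n ^ 2 ≤ ENNReal.ofReal (hnorm σ c ^ 2) := by
  have hfin : ∑' n, ENNReal.ofReal ((1 + knorm n ^ (2 * σ)) * ‖c n‖ ^ 2) ≠ ⊤ := by
    have h0 := hc.enorm_ne_top
    have h1 := hc (⌈2 * σ⌉₊)
    have h3 : (∑' n, ‖c n‖ₑ) * ((∑' n, ‖c n‖ₑ) + ∑' n, wt n ^ ⌈2 * σ⌉₊ * ‖c n‖ₑ) ≠ ⊤ :=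
      ENNReal.mul_ne_top h0 (ENNReal.add_ne_top.2 ⟨h0, h1⟩)
    refine ne_top_of_le_ne_top h3 ?_
    rw [← ENNReal.tsum_add, ← ENNReal.tsum_mul_left]
    refine ENNReal.tsum_le_tsum fun n => ?_
    have hk := knorm_nonneg n
    rw [ENNReal.ofReal_mul (by positivity), ENNReal.ofReal_add (by norm_num) (by positivity),
      ENNReal.ofReal_one, ENNReal.ofReal_pow (norm_nonneg _), ofReal_norm]
    have e1 : ENNReal.ofReal (knorm n ^ (2 * σ)) ≤ wt n ^ ⌈2 * σ⌉₊ := by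
      have := enorm_lam_symbol (2 * σ) (by linarith) n
      rwa [← ofReal_norm, Complex.norm_real, Real.norm_eq_abs,
        abs_of_nonneg (by positivity)] at this
    have e2 : ‖c n‖ₑ ≤ ∑' n, ‖c n‖ₑ := ENNReal.le_tsum (f := fun n => ‖c n‖ₑ) n
    calc _ = ‖c n‖ₑ * (‖c n‖ₑ + ENNReal.ofReal (knorm n ^ (2 * σ)) * ‖c n‖ₑ) := by ring
      _ ≤ _ := by gcongr
  have hterm : ∀ n, 0 ≤ (1 + knorm n ^ (2 * σ)) * ‖c n‖ ^ 2 := fun n => by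
    have hk := knorm_nonneg n
    positivity
  have heq : ENNReal.ofReal (hnorm σ c ^ 2) =
      ∑' n, ENNReal.ofReal ((1 + knorm n ^ (2 * σ)) * ‖c n‖ ^ 2) := by
    rw [hnorm, Real.sq_sqrt (tsum_nonneg hterm), ← ENNReal.ofReal_toReal hfin,
      ENNReal.tsum_toReal_eq (fun _ => ENNReal.ofReal_ne_top)]
    congr 2; funext n
    rw [ENNReal.toReal_ofReal (hterm n)]
  refine ⟨heq, ?_⟩
  rw [heq]
  refine ENNReal.tsum_le_tsum fun n => ?_
  have hk := knorm_nonneg n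
  rw [wf, ← ENNReal.ofReal_pow (by positivity)]
  apply ENNReal.ofReal_le_ofReal
  rw [mul_pow, ← Real.rpow_natCast (knorm n ^ σ), ← Real.rpow_mul hk]
  have : σ * ((2:ℕ):ℝ) = 2 * σ := by push_cast; ring
  rw [this]
  gcongr
  linarith

theorem hnormV3_sq {σ : ℝ} (hσ : 0 ≤ σ) {b : Fin 3 → Z3 → ℂ} (hb : ∀ j, Adm (b j)) :
    ∑' n, wf σ (bn b) n ^ 2 ≤ 3 * ENNReal.ofReal (hnormV3 σ b ^ 2) := by
  rw [hnormV3, Real.sq_sqrt (by positivity), ENNReal.ofReal_sum_of_nonneg (fun _ _ => by positivity),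
    Fin.sum_univ_three]
  calc ∑' n, wf σ (bn b) n ^ 2 ≤ ∑' n, 3 * (wf σ (fun k => ‖b 0 k‖) n ^ 2 +
        wf σ (fun k => ‖b 1 k‖) n ^ 2 + wf σ (fun k => ‖b 2 k‖) n ^ 2) := by
        refine ENNReal.tsum_le_tsum fun n => ?_
        refine le_trans (le_of_eq ?_) (add3_sq _ _ _)
        have hk := knorm_nonneg n
        simp only [wf]
        rw [← ENNReal.ofReal_add (by positivity) (by positivity),
          ← ENNReal.ofReal_add (by positivity) (by positivity), bn, Fin.sum_univ_three, mul_add,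
          mul_add]
    _ ≤ _ := by
        rw [ENNReal.tsum_mul_left, ENNReal.tsum_add, ENNReal.tsum_add]
        gcongr
        · exact (hnorm_sq hσ (hb 0)).2
        · exact (hnorm_sq hσ (hb 1)).2
        · exact (hnorm_sq hσ (hb 2)).2

/-- Let `s > 5/2`. There is `C = C(s) > 0` such that for every smooth
divergence-free zero-mean vector field `b` on `𝕋³` and every smooth real-valued zero-mean
function `f` on `𝕋³`, `‖[[Λ^s, b·∇], b·∇] f‖_{L²} ≤ C ‖b‖²_{H^{s+1}} ‖f‖_{H^s}`. -/
theorem stmt1 (s : ℝ) (hs : 5 / 2 < s) :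
    ∃ C : ℝ, 0 < C ∧
      ∀ b : Fin 3 → Z3 → ℂ, SmoothV3 b → DivFree b → (∀ j, ZeroMean (b j)) →
        ∀ f : Z3 → ℂ, SmoothFun f → ZeroMean f →
          l2norm (commLam s b (transport b f) - transport b (commLam s b f)) ≤
            C * hnormV3 (s + 1) b ^ 2 * hnorm s f := by
  obtain ⟨K, hK, hmain⟩ := main_ennreal hs
  refine ⟨3 * Real.sqrt K.toReal + 1, by positivity, ?_⟩
  intro b hb _ hb0 f hf _
  have hbA : ∀ j, Adm (b j) := fun j => Adm.of_rapid (hb j).2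
  have hfA : Adm f := Adm.of_rapid hf.2
  have h := hmain b f hbA hfA hb0
  set D := commLam s b (transport b f) - transport b (commLam s b f)
  have hf2 := (hnorm_sq (σ := s) (by linarith) hfA).2
  have hb2 := hnormV3_sq (σ := s + 1) (by linarith) hbA
  set Y := hnormV3 (s+1) b with hY
  set X := hnorm s f with hX
  have hY0 : 0 ≤ Y := Real.sqrt_nonneg _
  have hX0 : 0 ≤ X := Real.sqrt_nonneg _
  have h' : ∑' n, ‖D n‖ₑ ^ 2 ≤ ENNReal.ofReal (K.toReal * (3 * Y ^ 2) ^ 2 * X ^ 2) := by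
    refine h.trans ?_
    rw [ENNReal.ofReal_mul (by positivity), ENNReal.ofReal_mul (by positivity),
      ENNReal.ofReal_toReal hK, ENNReal.ofReal_pow (by positivity) 2,
      ENNReal.ofReal_mul (by norm_num), ENNReal.ofReal_ofNat]
    gcongr
  have hD : l2sq D ≤ K.toReal * (3 * Y ^ 2) ^ 2 * X ^ 2 := by
    have e : l2sq D = (∑' n, ‖D n‖ₑ ^ 2).toReal := by
      rw [ENNReal.tsum_toReal_eq (fun _ => ENNReal.pow_ne_top enorm_ne_top)]
      simp [l2sq]
    rw [e]
    exact ENNReal.toReal_le_of_le_ofReal (by positivity) h'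
  rw [l2norm]
  calc Real.sqrt (l2sq D) ≤ Real.sqrt (K.toReal * (3 * Y ^ 2) ^ 2 * X ^ 2) := Real.sqrt_le_sqrt hD
    _ = Real.sqrt K.toReal * (3 * Y ^ 2) * X := by
        rw [Real.sqrt_mul (by positivity), Real.sqrt_mul (by positivity),
          Real.sqrt_sq (by positivity), Real.sqrt_sq hX0]
    _ = 3 * Real.sqrt K.toReal * Y ^ 2 * X := by ring
    _ ≤ _ := by gcongr; linarith
end
end

section
/- Let s > 5/2. There exists a constant C = C(s) > 0 such that for every smooth divergence-free vector field b = (b¹,b²,b³) on 𝕋³ and every smooth ℝ²-valued function φ on 𝕋³ with 𝒫φ = φ, one has ‖Λ^{−1/2} [Λ^s, b·∇] [𝒫, b·∇] φ‖_{L²(𝕋³)} ≤ C ( ‖b‖²_{H^{s+3}} ‖φ‖_{H^{s−1/2}} + ‖b‖_{H^{s+3}} ‖∂_z(b¹,b²)‖_{H^{s−3/2}} ‖φ‖_{H^{s+1/2}} ). -/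
/-!
We model functions on the torus `𝕋³ = ℝ³/ℤ³` by their Fourier coefficients,
indexed by `n ∈ ℤ³` (the actual frequency being `k = 2πn ∈ 2πℤ³`).
Smoothness corresponds to rapid decay of the Fourier coefficients, real-valuedness
to the usual conjugation symmetry, products to convolution of coefficients, and
the `L²` norm/inner product are given by Plancherel.
-/

noncomputable section

open scoped BigOperators
open Complex

namespace Aux4

/-! ### Cauchy-Schwarz and Young for sums -/

lemma cs {ι : Type*} {f g : ι → ℝ} (hf : ∀ i, 0 ≤ f i) (hg : ∀ i, 0 ≤ g i)
    (hfs : Summable fun i => f i ^ 2) (hgs : Summable fun i => g i ^ 2) :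
    Summable (fun i => f i * g i) ∧
      (∑' i, f i * g i) ^ 2 ≤ (∑' i, f i ^ 2) * ∑' i, g i ^ 2 := by
  have hpq : (2 : ℝ).HolderConjugate 2 := Real.HolderConjugate.two_two
  have h := Real.summable_and_inner_le_Lp_mul_Lq_tsum_of_nonneg hpq hf hg
    (by simpa using hfs) (by simpa using hgs)
  refine ⟨h.1, ?_⟩
  have h2 := h.2
  have h0 : 0 ≤ ∑' i, f i * g i := tsum_nonneg fun i => mul_nonneg (hf i) (hg i)
  have hA : 0 ≤ ∑' i, f i ^ 2 := tsum_nonneg fun i => sq_nonneg _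
  have hB : 0 ≤ ∑' i, g i ^ 2 := tsum_nonneg fun i => sq_nonneg _
  simp only [Real.rpow_two, ← Real.sqrt_eq_rpow] at h2
  calc (∑' i, f i * g i) ^ 2 ≤ (√(∑' i, f i ^ 2) * √(∑' i, g i ^ 2)) ^ 2 := by gcongr
    _ = _ := by rw [mul_pow, Real.sq_sqrt hA, Real.sq_sqrt hB]

lemma bdd_of_summable {ι : Type*} {f : ι → ℝ} (hf : ∀ i, 0 ≤ f i) (h : Summable f) (i : ι) :
    f i ≤ ∑' j, f j := h.le_tsum i fun j _ => hf j

/-- The convolution of nonnegative sequences. -/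
def cv (F G : Z3 → ℝ) (n : Z3) : ℝ := ∑' m, F m * G (n - m)

lemma young {F G : Z3 → ℝ} (hF : ∀ i, 0 ≤ F i) (hG : ∀ i, 0 ≤ G i)
    (hFs : Summable F) (hGs : Summable fun i => G i ^ 2) :
    (∀ n, Summable fun m => F m * G (n - m)) ∧
    (Summable fun n => cv F G n ^ 2) ∧
    ∑' n, cv F G n ^ 2 ≤ (∑' m, F m) ^ 2 * ∑' p, G p ^ 2 := by
  let e : Z3 × Z3 ≃ Z3 × Z3 :=
    { toFun := fun x => (x.2, x.1 - x.2)
      invFun := fun y => (y.1 + y.2, y.1)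
      left_inv := fun x => by simp
      right_inv := fun x => by simp }
  have hK0 : Summable fun x : Z3 × Z3 => F x.1 * G x.2 ^ 2 :=
    hFs.mul_of_nonneg hGs hF (fun i => sq_nonneg _)
  have hK : Summable fun x : Z3 × Z3 => F x.2 * G (x.1 - x.2) ^ 2 :=
    (e.summable_iff).2 hK0
  have hT : ∑' n, ∑' m, F m * G (n - m) ^ 2 = (∑' m, F m) * ∑' p, G p ^ 2 := by
    rw [hFs.tsum_mul_tsum hGs hK0, ← e.tsum_eq, ← hK.tsum_prod]
    rfl
  have hcs : ∀ n, Summable (fun m => F m * G (n - m)) ∧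
      cv F G n ^ 2 ≤ (∑' m, F m) * ∑' m, F m * G (n - m) ^ 2 := by
    intro n
    have h := cs (f := fun m => √(F m)) (g := fun m => √(F m) * G (n - m))
      (fun m => Real.sqrt_nonneg _) (fun m => mul_nonneg (Real.sqrt_nonneg _) (hG _))
      (by simpa only [Real.sq_sqrt (hF _)] using hFs)
      (by simpa only [mul_pow, Real.sq_sqrt (hF _)] using hK.prod_factor n)
    simpa only [cv, mul_pow, Real.sq_sqrt (hF _), ← mul_assoc, Real.mul_self_sqrt (hF _)] using h
  have hS : Summable fun n => (∑' m, F m) * ∑' m, F m * G (n - m) ^ 2 := hK.prod.mul_left _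
  have hS2 : Summable fun n => cv F G n ^ 2 :=
    Summable.of_nonneg_of_le (fun n => sq_nonneg _) (fun n => (hcs n).2) hS
  refine ⟨fun n => (hcs n).1, hS2, ?_⟩
  calc ∑' n, cv F G n ^ 2 ≤ ∑' n, (∑' m, F m) * ∑' m, F m * G (n - m) ^ 2 :=
        hS2.tsum_le_tsum (fun n => (hcs n).2) hS
    _ = _ := by rw [tsum_mul_left, hT]; ring

/-! ### The weight `J n = 1 + |k|` -/

def J (n : Z3) : ℝ := 1 + knorm n

def eu (n : Z3) : EuclideanSpace ℝ (Fin 3) := WithLp.toLp 2 fun i => (n i : ℝ)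

lemma knorm_eq (n : Z3) : knorm n = 2 * Real.pi * ‖eu n‖ := by
  simp [knorm, eu, EuclideanSpace.norm_eq]

lemma knorm_nonneg (n : Z3) : 0 ≤ knorm n := by
  rw [knorm_eq]; positivity

lemma knorm_zero : knorm 0 = 0 := by simp [knorm]

lemma eu_add (m p : Z3) : eu (m + p) = eu m + eu p := by
  ext i; simp [eu]

lemma knorm_add_le (m p : Z3) : knorm (m + p) ≤ knorm m + knorm p := by
  simp only [knorm_eq, eu_add, ← mul_add]
  gcongr
  exact norm_add_le _ _

lemma knorm_neg (m : Z3) : knorm (-m) = knorm m := by simp [knorm]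

lemma abs_le_knorm (n : Z3) (i : Fin 3) : 2 * Real.pi * |(n i : ℝ)| ≤ knorm n := by
  unfold knorm
  gcongr
  rw [← Real.sqrt_sq_eq_abs]
  exact Real.sqrt_le_sqrt (Finset.single_le_sum (f := fun i => (n i : ℝ) ^ 2)
    (fun i _ => sq_nonneg _) (Finset.mem_univ i))

lemma two_pi_ge : 1 ≤ 2 * Real.pi := by nlinarith [Real.pi_gt_three]

lemma abs_le_knorm' (n : Z3) (i : Fin 3) : |(n i : ℝ)| ≤ knorm n := by
  refine le_trans ?_ (abs_le_knorm n i)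
  nlinarith [two_pi_ge, abs_nonneg (n i : ℝ)]

lemma one_le_knorm {n : Z3} (hn : n ≠ 0) : 1 ≤ knorm n := by
  obtain ⟨i, hi⟩ := Function.ne_iff.1 hn
  refine le_trans ?_ (abs_le_knorm' n i)
  have : 1 ≤ |n i| := Int.one_le_abs (by simpa using hi)
  exact_mod_cast this

lemma J_ge (n : Z3) : 1 ≤ J n := by unfold J; linarith [knorm_nonneg n]
lemma J_pos (n : Z3) : 0 < J n := lt_of_lt_of_le one_pos (J_ge n)
lemma knorm_le_J (n : Z3) : knorm n ≤ J n := by unfold J; linarith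
lemma abs_le_J (n : Z3) (i : Fin 3) : |(n i : ℝ)| ≤ J n := (abs_le_knorm' n i).trans (knorm_le_J n)

lemma Jr_pos (n : Z3) (r : ℝ) : 0 < J n ^ r := Real.rpow_pos_of_pos (J_pos n) r

lemma Jr_mono (n : Z3) {r t : ℝ} (h : r ≤ t) : J n ^ r ≤ J n ^ t :=
  Real.rpow_le_rpow_of_exponent_le (J_ge n) h

lemma Jr_add (n : Z3) (r t : ℝ) : J n ^ (r + t) = J n ^ r * J n ^ t :=
  Real.rpow_add (J_pos n) r t

lemma J_add_le (m p : Z3) : J (m + p) ≤ J m + J p := by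
  unfold J; linarith [knorm_add_le m p]

lemma J_add_le_mul (m p : Z3) : J (m + p) ≤ J m * J p := by
  unfold J; nlinarith [knorm_add_le m p, knorm_nonneg m, knorm_nonneg p,
    mul_nonneg (knorm_nonneg m) (knorm_nonneg p)]

lemma J_neg (m : Z3) : J (-m) = J m := by simp [J, knorm_neg]

/-- `J p ≤ J m * J (m+p)`. -/
lemma J_le_mul (m p : Z3) : J p ≤ J m * J (m + p) := by
  have := J_add_le_mul (-m) (m + p)
  simpa [J_neg] using this

lemma Jr_le_mul (m p : Z3) {r : ℝ} (hr : 0 ≤ r) : J (m + p) ^ r ≤ J m ^ r * J p ^ r := by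
  rw [← Real.mul_rpow (J_pos m).le (J_pos p).le]
  exact Real.rpow_le_rpow (J_pos _).le (J_add_le_mul m p) hr

lemma Jr_le_add (m p : Z3) {r : ℝ} (hr : 0 ≤ r) :
    J (m + p) ^ r ≤ 2 ^ r * (J m ^ r + J p ^ r) := by
  have h1 : J (m + p) ≤ 2 * max (J m) (J p) := by
    have := J_add_le m p
    linarith [le_max_left (J m) (J p), le_max_right (J m) (J p)]
  calc J (m + p) ^ r ≤ (2 * max (J m) (J p)) ^ r := Real.rpow_le_rpow (J_pos _).le h1 hr
    _ = 2 ^ r * (max (J m) (J p)) ^ r :=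
        Real.mul_rpow (by norm_num) (le_trans (J_pos m).le (le_max_left _ _))
    _ ≤ _ := by
        gcongr
        rcases max_choice (J m) (J p) with h | h <;> rw [h]
        · linarith [Jr_pos p r]
        · linarith [Jr_pos m r]

/-! ### The key pointwise commutator bound -/

lemma rpow_sub_le {s a b M : ℝ} (hs : 1 ≤ s) (ha : 0 ≤ a) (hb : 0 ≤ b) (haM : a ≤ M)
    (hbM : b ≤ M) : |a ^ s - b ^ s| ≤ s * M ^ (s - 1) * |a - b| := by
  have h := Convex.norm_image_sub_le_of_norm_deriv_le (𝕜 := ℝ) (f := fun x : ℝ => x ^ s)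
    (s := Set.Icc 0 M) (x := b) (y := a) (C := s * M ^ (s - 1))
    (fun x _ => ((hasDerivAt_id x).rpow_const (Or.inr hs)).differentiableAt)
    (fun x hx => by
      have hd : deriv (fun x : ℝ => x ^ s) x = s * x ^ (s - 1) := by
        simpa using ((hasDerivAt_id x).rpow_const (p := s) (Or.inr hs)).deriv
      rw [hd, Real.norm_of_nonneg (mul_nonneg (by linarith) (Real.rpow_nonneg hx.1 _))]
      have := Real.rpow_le_rpow hx.1 hx.2 (by linarith : 0 ≤ s - 1)
      gcongr)
    (convex_Icc _ _) ⟨hb, hbM⟩ ⟨ha, haM⟩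
  simpa [Real.norm_eq_abs] using h

lemma comm_bound {s : ℝ} (hs : 1 ≤ s) (m p : Z3) :
    knorm (m + p) ^ (-(1 / 2) : ℝ) * |knorm (m + p) ^ s - knorm p ^ s| * knorm p
      ≤ (2 * s) * (J m ^ (s + 1 / 2) * J p ^ (s - 1 / 2)) := by
  by_cases hn : m + p = 0
  · have : (0 : ℝ) ≤ (2 * s) * (J m ^ (s + 1 / 2) * J p ^ (s - 1 / 2)) := by
      have := Jr_pos m (s + 1/2); have := Jr_pos p (s - 1/2); positivity
    rw [hn, knorm_zero, Real.zero_rpow (by norm_num)]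
    simpa using this
  have h1 : knorm (m + p) ^ (-(1 / 2) : ℝ) ≤ 2 * (J m ^ (1 / 2 : ℝ) * J p ^ (-(1 / 2) : ℝ)) := by
    have hk := one_le_knorm hn
    have hk0 : 0 < knorm (m + p) := by linarith
    have h2 : J p ≤ 4 * J m * knorm (m + p) := by
      have := J_le_mul m p
      have h3 : J (m + p) ≤ 2 * knorm (m + p) := by unfold J; linarith
      nlinarith [J_pos m, mul_pos (J_pos m) hk0]
    have h4 := Real.rpow_le_rpow (J_pos p).le h2 (by norm_num : (0 : ℝ) ≤ 1 / 2)
    rw [Real.mul_rpow (by linarith [J_pos m]) hk0.le, Real.mul_rpow (by norm_num) (J_pos m).le,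
      show (4 : ℝ) = 2 ^ (2 : ℝ) by norm_num, ← Real.rpow_mul (by norm_num)] at h4
    norm_num at h4
    rw [Real.rpow_neg hk0.le, Real.rpow_neg (J_pos p).le, inv_eq_one_div, div_le_iff₀ (by positivity),
      ← div_eq_mul_inv, mul_div_assoc', div_mul_eq_mul_div, le_div_iff₀ (Jr_pos _ _), one_mul]
    exact h4
  have h2 : |knorm (m + p) ^ s - knorm p ^ s| ≤ s * (J m ^ (s - 1) * J p ^ (s - 1)) * J m := by
    have ha : knorm (m + p) ≤ J m * J p := (knorm_le_J _).trans (J_add_le_mul m p)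
    have hb : knorm p ≤ J m * J p := (knorm_le_J _).trans
      (by nlinarith [J_ge m, J_pos p])
    have hd : |knorm (m + p) - knorm p| ≤ J m := by
      refine le_trans ?_ (knorm_le_J m)
      rw [abs_le]
      have := knorm_add_le (-m) (m + p)
      rw [knorm_neg, neg_add_cancel_left] at this
      constructor <;> linarith [knorm_add_le m p]
    refine (rpow_sub_le hs (knorm_nonneg _) (knorm_nonneg _) ha hb).trans ?_
    rw [Real.mul_rpow (J_pos m).le (J_pos p).le]
    have := Jr_pos m (s - 1); have := Jr_pos p (s - 1)
    gcongr
  have h3 := knorm_le_J p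
  have e1 : J m ^ (s + 1 / 2) = J m ^ (1 / 2 : ℝ) * J m ^ (s - 1) * J m := by
    rw [← Jr_add]
    nth_rewrite 3 [← Real.rpow_one (J m)]
    rw [← Jr_add]; congr 1; ring
  have e2 : J p ^ (s - 1 / 2) = J p ^ (-(1 / 2) : ℝ) * J p ^ (s - 1) * J p := by
    rw [← Jr_add]
    nth_rewrite 3 [← Real.rpow_one (J p)]
    rw [← Jr_add]; congr 1; ring
  have q1 := Jr_pos m (1 / 2); have q2 := Jr_pos m (s - 1)
  have q3 := Jr_pos p (-(1 / 2)); have q4 := Jr_pos p (s - 1)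
  have q5 := J_pos m; have q6 := J_pos p
  calc _ ≤ (2 * (J m ^ (1 / 2 : ℝ) * J p ^ (-(1 / 2) : ℝ))) *
        (s * (J m ^ (s - 1) * J p ^ (s - 1)) * J m) * J p := by
        have := knorm_nonneg p
        gcongr
    _ = _ := by rw [e1, e2]; ring

/-! ### Summability of the product weight -/

def P (a : ℝ) (m : Z3) : ℝ :=
  (1 + |(m 0 : ℝ)|) ^ (-a) * ((1 + |(m 1 : ℝ)|) ^ (-a) * (1 + |(m 2 : ℝ)|) ^ (-a))

lemma P_nonneg (a : ℝ) (m : Z3) : 0 ≤ P a m := by unfold P; positivity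

lemma summable_int {a : ℝ} (ha : 1 < a) : Summable fun k : ℤ => (1 + |(k : ℝ)|) ^ (-a) := by
  have h := Real.summable_abs_int_rpow ha
  refine Summable.of_norm_bounded_eventually h ?_
  rw [Filter.eventually_cofinite]
  refine (Set.finite_singleton (0 : ℤ)).subset fun k hk => ?_
  by_contra h0
  apply hk
  rw [Real.norm_of_nonneg (by positivity)]
  have : 0 < |(k : ℝ)| := by
    have : (k : ℝ) ≠ 0 := by exact_mod_cast h0
    positivity
  exact Real.rpow_le_rpow_of_nonpos this (by linarith) (by linarith)

lemma summable_P {a : ℝ} (ha : 1 < a) : Summable (P a) := by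
  have h := summable_int ha
  have hp : ∀ k : ℤ, 0 ≤ (1 + |(k : ℝ)|) ^ (-a) := fun k => by positivity
  have h2 := h.mul_of_nonneg h hp hp
  have h3 := h.mul_of_nonneg h2 hp (fun x => mul_nonneg (hp x.1) (hp x.2))
  let i : Z3 → ℤ × (ℤ × ℤ) := fun m => (m 0, m 1, m 2)
  have hi : Function.Injective i := by
    intro m n h
    simp only [i, Prod.mk.injEq] at h
    funext j; fin_cases j <;> simp [h]
  have h4 := h3.comp_injective hi
  simp only [Function.comp_def, i] at h4
  have e : P a = fun x => (1 + |(x 0 : ℝ)|) ^ (-a) *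
      ((1 + |(x 1 : ℝ)|) ^ (-a) * (1 + |(x 2 : ℝ)|) ^ (-a)) := funext fun m => rfl
  rw [e]
  exact h4

lemma P_mul_eq (a : ℝ) (m : Z3) : P a m *
    ((1 + |(m 0 : ℝ)|) ^ a * ((1 + |(m 1 : ℝ)|) ^ a * (1 + |(m 2 : ℝ)|) ^ a)) = 1 := by
  unfold P
  have h : ∀ x : ℝ, (1 + |x|) ^ (-a) * (1 + |x|) ^ a = 1 := fun x => by
    rw [← Real.rpow_add (by positivity)]; simp
  calc _ = ((1 + |(m 0 : ℝ)|) ^ (-a) * (1 + |(m 0 : ℝ)|) ^ a) *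
      (((1 + |(m 1 : ℝ)|) ^ (-a) * (1 + |(m 1 : ℝ)|) ^ a) *
      ((1 + |(m 2 : ℝ)|) ^ (-a) * (1 + |(m 2 : ℝ)|) ^ a)) := by ring
    _ = 1 := by rw [h, h, h]; norm_num

lemma one_add_abs_rpow_le {a : ℝ} (ha : 0 ≤ a) (m : Z3) (i : Fin 3) :
    (1 + |(m i : ℝ)|) ^ a ≤ J m ^ a :=
  Real.rpow_le_rpow (by positivity) (by unfold J; linarith [abs_le_knorm' m i]) ha

lemma Jneg_le_P {a : ℝ} (ha : 0 ≤ a) (ha' : a ≤ 5 / 3) (m : Z3) : J m ^ (-5 : ℝ) ≤ P a m := by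
  have h := P_mul_eq a m
  have h1 : (1 + |(m 0 : ℝ)|) ^ a * ((1 + |(m 1 : ℝ)|) ^ a * (1 + |(m 2 : ℝ)|) ^ a) ≤ J m ^ (5 : ℝ) := by
    have := one_add_abs_rpow_le ha m
    have hp := Jr_pos m a
    calc _ ≤ J m ^ a * (J m ^ a * J m ^ a) := mul_le_mul (this 0)
          (mul_le_mul (this 1) (this 2) (by positivity) hp.le) (by positivity) hp.le
      _ = J m ^ (a + (a + a)) := by rw [Jr_add, Jr_add]
      _ ≤ _ := Jr_mono m (by linarith)
  rw [Real.rpow_neg (J_pos m).le, inv_eq_one_div, div_le_iff₀ (Jr_pos _ _)]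
  calc (1 : ℝ) = _ := h.symm
    _ ≤ _ := mul_le_mul_of_nonneg_left h1 (P_nonneg _ _)

lemma Jneg_le_P' {a σ : ℝ} (ha : 0 ≤ a) (ha' : a ≤ σ) (ha2 : a ≤ 2) (m : Z3) (hm : m 2 ≠ 0) :
    (J m ^ (-σ) / |(m 2 : ℝ)|) ^ 2 ≤ 4 * P a m := by
  have h := P_mul_eq a m
  have hm1 : 1 ≤ |(m 2 : ℝ)| := by exact_mod_cast Int.one_le_abs hm
  have h3 : (1 + |(m 2 : ℝ)|) ^ a ≤ 4 * |(m 2 : ℝ)| ^ 2 := by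
    calc (1 + |(m 2 : ℝ)|) ^ a ≤ (1 + |(m 2 : ℝ)|) ^ (2 : ℝ) :=
          Real.rpow_le_rpow_of_exponent_le (by linarith) ha2
      _ = (1 + |(m 2 : ℝ)|) ^ 2 := by norm_num
      _ ≤ _ := by nlinarith
  have h1 : (1 + |(m 0 : ℝ)|) ^ a * ((1 + |(m 1 : ℝ)|) ^ a * (1 + |(m 2 : ℝ)|) ^ a)
      ≤ J m ^ σ * (J m ^ σ * (4 * |(m 2 : ℝ)| ^ 2)) := by
    have := fun i => (one_add_abs_rpow_le ha m i).trans (Jr_mono m ha')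
    have hp := Jr_pos m σ
    exact mul_le_mul (this 0) (mul_le_mul (this 1) h3 (by positivity) hp.le) (by positivity) hp.le
  rw [div_pow, Real.rpow_neg (J_pos m).le, div_le_iff₀ (by positivity), inv_pow, inv_eq_one_div,
    div_le_iff₀ (pow_pos (Jr_pos _ _) 2)]
  calc (1 : ℝ) = _ := h.symm
    _ ≤ _ := mul_le_mul_of_nonneg_left h1 (P_nonneg _ _)
    _ = _ := by ring

/-! ### Rapid decay -/

def Dec (c : Z3 → ℂ) : Prop := ∀ r : ℝ, ∃ C : ℝ, ∀ n, J n ^ r * ‖c n‖ ≤ C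

lemma dec_of_rapid {c : Z3 → ℂ} (h : RapidDecay c) : Dec c := by
  intro r
  obtain ⟨C, hC⟩ := h ⌈r⌉₊
  refine ⟨C, fun n => le_trans ?_ (hC n)⟩
  rw [mul_comm]
  have : J n ^ r ≤ (1 + knorm n) ^ ⌈r⌉₊ := by
    rw [← Real.rpow_natCast]
    exact Jr_mono n (Nat.le_ceil r)
  gcongr

lemma dec_of_le {c d : Z3 → ℂ} (h : Dec c) (t : ℝ) (hd : ∀ n, ‖d n‖ ≤ J n ^ t * ‖c n‖) :
    Dec d := by
  intro r
  obtain ⟨C, hC⟩ := h (r + t)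
  refine ⟨C, fun n => le_trans ?_ (hC n)⟩
  rw [Jr_add, mul_assoc]
  exact mul_le_mul_of_nonneg_left (hd n) (Jr_pos n r).le

lemma norm_pd_le (j : Fin 3) (c : Z3 → ℂ) (n : Z3) : ‖pd j c n‖ ≤ knorm n * ‖c n‖ := by
  unfold pd
  rw [norm_mul, norm_mul, Complex.norm_I, one_mul]
  refine mul_le_mul_of_nonneg_right ?_ (norm_nonneg _)
  rw [Complex.norm_real, Real.norm_eq_abs, abs_mul, abs_of_pos (by positivity)]
  exact abs_le_knorm n j

lemma dec_pd {c : Z3 → ℂ} (h : Dec c) (j : Fin 3) : Dec (pd j c) := by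
  refine dec_of_le h 1 fun n => (norm_pd_le j c n).trans ?_
  rw [Real.rpow_one]
  exact mul_le_mul_of_nonneg_right (knorm_le_J n) (norm_nonneg _)

lemma dec_lam {c : Z3 → ℂ} (h : Dec c) {s : ℝ} (hs : 0 ≤ s) : Dec (lam s c) := by
  refine dec_of_le h s fun n => ?_
  unfold lam
  rw [norm_mul, Complex.norm_real, Real.norm_of_nonneg (Real.rpow_nonneg (knorm_nonneg n) _)]
  exact mul_le_mul_of_nonneg_right (Real.rpow_le_rpow (knorm_nonneg n) (knorm_le_J n) hs)
    (norm_nonneg _)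

lemma Dec.summable {c : Z3 → ℂ} (h : Dec c) (r : ℝ) : Summable fun n => J n ^ r * ‖c n‖ := by
  obtain ⟨C, hC⟩ := h (r + 5)
  have hP := (summable_P (a := 5 / 3) (by norm_num)).mul_left |C|
  refine Summable.of_nonneg_of_le (fun n => mul_nonneg (Jr_pos n r).le (norm_nonneg _))
    (fun n => ?_) hP
  have h1 : J n ^ r = J n ^ (r + 5) * J n ^ (-5 : ℝ) := by rw [← Jr_add]; congr 1; ring
  calc J n ^ r * ‖c n‖ = (J n ^ (r + 5) * ‖c n‖) * J n ^ (-5 : ℝ) := by rw [h1]; ring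
    _ ≤ |C| * P (5 / 3) n := mul_le_mul ((hC n).trans (le_abs_self C))
        (Jneg_le_P (by norm_num) le_rfl n) (Jr_pos _ _).le (abs_nonneg _)

lemma Dec.summable_norm {c : Z3 → ℂ} (h : Dec c) : Summable fun n => ‖c n‖ := by
  simpa using h.summable 0

lemma Dec.summable_sq {c : Z3 → ℂ} (h : Dec c) (r : ℝ) :
    Summable fun n => (J n ^ r * ‖c n‖) ^ 2 := by
  obtain ⟨C, hC⟩ := h r
  refine Summable.of_nonneg_of_le (fun n => sq_nonneg _) (fun n => ?_) ((h.summable r).mul_left C)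
  have : 0 ≤ J n ^ r * ‖c n‖ := mul_nonneg (Jr_pos n r).le (norm_nonneg _)
  rw [sq]
  exact mul_le_mul_of_nonneg_right (hC n) this

lemma Dec.bound {c : Z3 → ℂ} (h : Dec c) (r : ℝ) : ∃ C : ℝ, 0 ≤ C ∧ ∀ n, J n ^ r * ‖c n‖ ≤ C := by
  obtain ⟨C, hC⟩ := h r
  exact ⟨|C|, abs_nonneg C, fun n => (hC n).trans (le_abs_self C)⟩

lemma conv_summable {c d : Z3 → ℂ} (hc : Dec c) (hd : Dec d) (n : Z3) :
    Summable fun m => c m * d (n - m) := by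
  obtain ⟨C, -, hC⟩ := hd.bound 0
  refine Summable.of_norm_bounded (hc.summable_norm.mul_right C) fun m => ?_
  rw [norm_mul]
  exact mul_le_mul_of_nonneg_left (by simpa using hC (n - m)) (norm_nonneg _)

lemma dec_conv {c d : Z3 → ℂ} (hc : Dec c) (hd : Dec d) : Dec (conv c d) := by
  intro r
  set t := max r 0
  obtain ⟨C, hC0, hC⟩ := hd.bound t
  refine ⟨∑' m, (J m ^ t * ‖c m‖) * C, fun n => ?_⟩
  have hs := (hc.summable t).mul_right C
  have : ‖conv c d n‖ ≤ ∑' m, (J n ^ t)⁻¹ * ((J m ^ t * ‖c m‖) * C) := by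
    refine tsum_of_norm_bounded (hs.mul_left _).hasSum fun m => ?_
    rw [norm_mul, ← div_eq_inv_mul, le_div_iff₀ (Jr_pos n t)]
    have h1 : J n ^ t ≤ J m ^ t * J (n - m) ^ t := by
      have := Jr_le_mul m (n - m) (le_max_right r 0)
      simpa using this
    calc ‖c m‖ * ‖d (n - m)‖ * J n ^ t ≤ ‖c m‖ * ‖d (n - m)‖ * (J m ^ t * J (n - m) ^ t) := by
          gcongr
      _ = (J m ^ t * ‖c m‖) * (J (n - m) ^ t * ‖d (n - m)‖) := by ring
      _ ≤ _ := by
          have := Jr_pos m t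
          have := hC (n - m)
          gcongr
  rw [tsum_mul_left, ← div_eq_inv_mul, le_div_iff₀ (Jr_pos n t)] at this
  refine le_trans ?_ this
  rw [mul_comm]
  exact mul_le_mul_of_nonneg_left (Jr_mono n (le_max_left _ _)) (norm_nonneg _)

lemma dec_add {c d : Z3 → ℂ} (hc : Dec c) (hd : Dec d) : Dec (fun n => c n + d n) := by
  intro r
  obtain ⟨C, hC⟩ := hc r
  obtain ⟨D, hD⟩ := hd r
  refine ⟨C + D, fun n => ?_⟩
  have := mul_le_mul_of_nonneg_left (norm_add_le (c n) (d n)) (Jr_pos n r).le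
  linarith [hC n, hD n]

lemma dec_transport {b : Fin 3 → Z3 → ℂ} {c : Z3 → ℂ} (hb : ∀ j, Dec (b j)) (hc : Dec c) :
    Dec (transport b c) := by
  unfold transport
  simp only [Fin.sum_univ_three]
  exact dec_add (dec_add (dec_conv (hb 0) (dec_pd hc 0)) (dec_conv (hb 1) (dec_pd hc 1)))
    (dec_conv (hb 2) (dec_pd hc 2))

/-! ### Sobolev norms -/

lemma hnorm_sq (σ : ℝ) (c : Z3 → ℂ) :
    hnorm σ c ^ 2 = ∑' n, (1 + knorm n ^ (2 * σ)) * ‖c n‖ ^ 2 := by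
  unfold hnorm
  refine Real.sq_sqrt (tsum_nonneg fun n => ?_)
  have := Real.rpow_nonneg (knorm_nonneg n) (2 * σ)
  positivity

lemma Jr_sq (n : Z3) (σ : ℝ) : (J n ^ σ) ^ 2 = J n ^ (2 * σ) := by
  rw [two_mul, Jr_add, sq]

lemma hsq {σ : ℝ} (hσ : 0 ≤ σ) {c : Z3 → ℂ} (hc : Dec c) :
    ∑' n, (J n ^ σ * ‖c n‖) ^ 2 ≤ 2 ^ (2 * σ) * hnorm σ c ^ 2 := by
  have hk : ∀ n : Z3, 0 ≤ knorm n ^ (2 * σ) := fun n => Real.rpow_nonneg (knorm_nonneg n) _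
  have hs : Summable fun n => (1 + knorm n ^ (2 * σ)) * ‖c n‖ ^ 2 := by
    refine Summable.of_nonneg_of_le (fun n => ?_) (fun n => ?_) ((hc.summable_sq σ).mul_left 2)
    · have := hk n; positivity
    · rw [mul_pow, Jr_sq, ← mul_assoc]
      refine mul_le_mul_of_nonneg_right ?_ (sq_nonneg _)
      have h1 : knorm n ^ (2 * σ) ≤ J n ^ (2 * σ) :=
        Real.rpow_le_rpow (knorm_nonneg n) (knorm_le_J n) (by linarith)
      have h2 : 1 ≤ J n ^ (2 * σ) := Real.one_le_rpow (J_ge n) (by linarith)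
      linarith
  rw [hnorm_sq, ← tsum_mul_left]
  refine (hc.summable_sq σ).tsum_le_tsum (fun n => ?_) (hs.mul_left _)
  rw [mul_pow, Jr_sq, ← mul_assoc]
  refine mul_le_mul_of_nonneg_right ?_ (sq_nonneg _)
  have h1 : J n ≤ 2 * max 1 (knorm n) := by
    unfold J; linarith [le_max_left 1 (knorm n), le_max_right 1 (knorm n)]
  calc J n ^ (2 * σ) ≤ (2 * max 1 (knorm n)) ^ (2 * σ) :=
        Real.rpow_le_rpow (J_pos n).le h1 (by linarith)
    _ = 2 ^ (2 * σ) * (max 1 (knorm n)) ^ (2 * σ) :=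
        Real.mul_rpow (by norm_num) (le_trans zero_le_one (le_max_left _ _))
    _ ≤ _ := by
        gcongr
        rcases max_choice 1 (knorm n) with h | h <;> rw [h]
        · rw [Real.one_rpow]; linarith [hk n]
        · linarith

lemma hsqV {k : ℕ} {σ : ℝ} (hσ : 0 ≤ σ) {V : Fin k → Z3 → ℂ} (hV : ∀ j, Dec (V j)) :
    (Summable fun n => (J n ^ σ * ∑ j, ‖V j n‖) ^ 2) ∧
    ∑' n, (J n ^ σ * ∑ j, ‖V j n‖) ^ 2 ≤ k * 2 ^ (2 * σ) * ∑ j, hnorm σ (V j) ^ 2 := by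
  have hp : ∀ n, (J n ^ σ * ∑ j, ‖V j n‖) ^ 2 ≤ k * ∑ j, (J n ^ σ * ‖V j n‖) ^ 2 := by
    intro n
    rw [Finset.mul_sum]
    simpa using sq_sum_le_card_mul_sum_sq (s := Finset.univ) (f := fun j => J n ^ σ * ‖V j n‖)
  have hs1 : Summable fun n => ∑ j, (J n ^ σ * ‖V j n‖) ^ 2 :=
    summable_sum fun j _ => (hV j).summable_sq σ
  have hs : Summable fun n => (J n ^ σ * ∑ j, ‖V j n‖) ^ 2 :=
    Summable.of_nonneg_of_le (fun n => sq_nonneg _) hp (hs1.mul_left _)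
  refine ⟨hs, (hs.tsum_le_tsum hp (hs1.mul_left _)).trans ?_⟩
  rw [tsum_mul_left, Summable.tsum_finsetSum fun j _ => (hV j).summable_sq σ, mul_assoc,
    Finset.mul_sum (a := (2 : ℝ) ^ (2 * σ))]
  gcongr with j
  exact hsq hσ (hV j)

/-- Weighted `ℓ¹` bound. -/
lemma l1bound {a : ℝ} (ha : 1 < a) {x u v : Z3 → ℝ} {K : ℝ} (hx : ∀ m, 0 ≤ x m)
    (hu : ∀ m, 0 ≤ u m) (hv : ∀ m, 0 ≤ v m) (hxu : ∀ m, x m ≤ u m * v m)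
    (huP : ∀ m, u m ^ 2 ≤ K * P a m) (hvs : Summable fun m => v m ^ 2) :
    Summable x ∧ (∑' m, x m) ^ 2 ≤ (K * ∑' m, P a m) * ∑' m, v m ^ 2 := by
  have hPs := (summable_P ha).mul_left K
  have hus : Summable fun m => u m ^ 2 :=
    Summable.of_nonneg_of_le (fun n => sq_nonneg _) huP hPs
  obtain ⟨h1, h2⟩ := cs hu hv hus hvs
  have hxs := Summable.of_nonneg_of_le hx hxu h1
  refine ⟨hxs, ?_⟩
  have h3 := hxs.tsum_le_tsum hxu h1
  have h4 := hus.tsum_le_tsum huP hPs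
  rw [tsum_mul_left] at h4
  calc (∑' m, x m) ^ 2 ≤ (∑' m, u m * v m) ^ 2 := pow_le_pow_left₀ (tsum_nonneg hx) h3 2
    _ ≤ _ := h2
    _ ≤ _ := mul_le_mul_of_nonneg_right h4 (tsum_nonneg fun m => sq_nonneg _)

/-! ### The outer commutator -/

lemma outer {s : ℝ} (hs : 1 ≤ s) {b : Fin 3 → Z3 → ℂ} {c : Z3 → ℂ} (hb : ∀ j, Dec (b j))
    (hc : Dec c) (n : Z3)
    (hS : Summable fun m => (J m ^ (s + 1 / 2) * ∑ j, ‖b j m‖) * (J (n - m) ^ (s - 1 / 2) * ‖c (n - m)‖)) :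
    ‖lam (-(1 / 2)) (commLam s b c) n‖ ≤
      2 * s * cv (fun m => J m ^ (s + 1 / 2) * ∑ j, ‖b j m‖) (fun p => J p ^ (s - 1 / 2) * ‖c p‖) n := by
  have hterm : ∀ j, Summable fun m => b j m * pd j c (n - m) :=
    fun j => conv_summable (hb j) (dec_pd hc j) n
  have hterm2 : ∀ j, Summable fun m => b j m * pd j (lam s c) (n - m) :=
    fun j => conv_summable (hb j) (dec_pd (dec_lam hc (by linarith)) j) n
  have hid : lam (-(1 / 2)) (commLam s b c) n = ∑' m, ∑ j,
      ((knorm n ^ (-(1 / 2) : ℝ) * (knorm n ^ s - knorm (n - m) ^ s) : ℝ) : ℂ) *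
        (b j m * pd j c (n - m)) := by
    have e : ∀ m, (∑ j, ((knorm n ^ (-(1 / 2) : ℝ) * (knorm n ^ s - knorm (n - m) ^ s) : ℝ) : ℂ) *
        (b j m * pd j c (n - m))) = ∑ j, ((knorm n ^ (-(1 / 2) : ℝ) : ℝ) : ℂ) *
        (((knorm n ^ s : ℝ) : ℂ) * (b j m * pd j c (n - m)) - b j m * pd j (lam s c) (n - m)) := by
      intro m
      refine Finset.sum_congr rfl fun j _ => ?_
      simp only [pd, lam]
      push_cast
      ring
    rw [tsum_congr e, Summable.tsum_finsetSum
      (fun j _ => (((hterm j).mul_left _).sub (hterm2 j)).mul_left _)]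
    simp only [tsum_mul_left]
    have e2 : ∀ j, ∑' m, (((knorm n ^ s : ℝ) : ℂ) * (b j m * pd j c (n - m)) -
        b j m * pd j (lam s c) (n - m)) = ((knorm n ^ s : ℝ) : ℂ) * conv (b j) (pd j c) n -
        conv (b j) (pd j (lam s c)) n := fun j => by
      rw [((hterm j).mul_left _).tsum_sub (hterm2 j), tsum_mul_left]; rfl
    simp only [e2]
    rw [← Finset.mul_sum, Finset.sum_sub_distrib, ← Finset.mul_sum]
    simp only [lam, commLam, transport, Pi.sub_apply]
  rw [hid]
  rw [cv, ← tsum_mul_left]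
  refine tsum_of_norm_bounded (hS.mul_left (2 * s)).hasSum fun m => ?_
  have hcb := comm_bound hs m (n - m)
  rw [add_sub_cancel] at hcb
  have hkn := Real.rpow_nonneg (knorm_nonneg n) (-(1 / 2))
  calc _ ≤ ∑ j, (knorm n ^ (-(1 / 2) : ℝ) * |knorm n ^ s - knorm (n - m) ^ s| * knorm (n - m)) *
        (‖b j m‖ * ‖c (n - m)‖) := by
        refine (norm_sum_le _ _).trans (Finset.sum_le_sum fun j _ => ?_)
        rw [norm_mul, Complex.norm_real, norm_mul, norm_mul, Real.norm_of_nonneg hkn,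
          Real.norm_eq_abs]
        calc _ ≤ knorm n ^ (-(1 / 2) : ℝ) * |knorm n ^ s - knorm (n - m) ^ s| *
              (‖b j m‖ * (knorm (n - m) * ‖c (n - m)‖)) := by
              gcongr
              exact norm_pd_le _ _ _
          _ = _ := by ring
    _ = (knorm n ^ (-(1 / 2) : ℝ) * |knorm n ^ s - knorm (n - m) ^ s| * knorm (n - m)) *
        ((∑ j, ‖b j m‖) * ‖c (n - m)‖) := by rw [← Finset.mul_sum, Finset.sum_mul]
    _ ≤ (2 * s * (J m ^ (s + 1 / 2) * J (n - m) ^ (s - 1 / 2))) *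
        ((∑ j, ‖b j m‖) * ‖c (n - m)‖) :=
        mul_le_mul_of_nonneg_right hcb (by positivity)
    _ = _ := by ring
/-! ### The inner commutator -/

lemma orth {φ : Fin 2 → Z3 → ℂ} (h : hproj φ = φ) (p : Z3) (hp : p 2 = 0) :
    (p 0 : ℂ) * φ 0 p + (p 1 : ℂ) * φ 1 p = 0 := by
  by_cases h0 : p 0 = 0 ∧ p 1 = 0
  · simp [h0.1, h0.2]
  have hN : ((p 0 : ℂ)) ^ 2 + ((p 1 : ℂ)) ^ 2 ≠ 0 := by
    intro h1
    have h2 : (p 0) ^ 2 + (p 1) ^ 2 = 0 := by exact_mod_cast h1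
    apply h0
    constructor <;> nlinarith [sq_nonneg (p 0), sq_nonneg (p 1)]
  have e0 := congrFun (congrFun h 0) p
  have e1 := congrFun (congrFun h 1) p
  simp only [hproj, hp, h0, not_false_eq_true, and_self, if_true, sub_eq_self, div_eq_zero_iff,
    hN, or_false] at e0 e1
  have c0 : (Fin.castSucc (0 : Fin 2)) = (0 : Fin 3) := rfl
  have c1 : (Fin.castSucc (1 : Fin 2)) = (1 : Fin 3) := rfl
  rw [c0] at e0
  rw [c1] at e1
  set D := (p 0 : ℂ) * φ 0 p + (p 1 : ℂ) * φ 1 p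
  have : (((p 0 : ℂ)) ^ 2 + ((p 1 : ℂ)) ^ 2) * D = 0 := by
    linear_combination (p 0 : ℂ) * e0 + (p 1 : ℂ) * e1
  exact (mul_eq_zero.1 this).resolve_left hN

lemma commProj_zero {b : Fin 3 → Z3 → ℂ} {φ : Fin 2 → Z3 → ℂ} (h : hproj φ = φ) (i : Fin 2)
    (n : Z3) (hn : ¬ (n 2 = 0 ∧ ¬(n 0 = 0 ∧ n 1 = 0))) : commProj b φ i n = 0 := by
  unfold commProj
  rw [h]
  simp only [hproj, Pi.sub_apply, if_neg hn, sub_self]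

lemma commProj_eq {b : Fin 3 → Z3 → ℂ} {φ : Fin 2 → Z3 → ℂ} (h : hproj φ = φ) (i : Fin 2)
    (n : Z3) (hn : n 2 = 0 ∧ ¬(n 0 = 0 ∧ n 1 = 0)) : commProj b φ i n =
      -((n i.castSucc : ℂ) / (((n 0 : ℂ)) ^ 2 + ((n 1 : ℂ)) ^ 2)) *
        ((n 0 : ℂ) * transport b (φ 0) n + (n 1 : ℂ) * transport b (φ 1) n) := by
  unfold commProj
  rw [h]
  simp only [hproj, Pi.sub_apply, if_pos hn, transportV]
  ring

/-- Division by the squared length. -/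
lemma frac_bound (i : Fin 2) (n : Z3) (hn : ¬(n 0 = 0 ∧ n 1 = 0)) (x y : ℂ) :
    ‖-((n i.castSucc : ℂ) / (((n 0 : ℂ)) ^ 2 + ((n 1 : ℂ)) ^ 2)) *
        ((n 0 : ℂ) * x + (n 1 : ℂ) * y)‖ ≤ ‖x‖ + ‖y‖ := by
  have hN : (0 : ℝ) < (n 0 : ℝ) ^ 2 + (n 1 : ℝ) ^ 2 := by
    rcases not_and_or.1 hn with h | h
    · have : (n 0 : ℝ) ≠ 0 := by exact_mod_cast h
      positivity
    · have : (n 1 : ℝ) ≠ 0 := by exact_mod_cast h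
      positivity
  have e : ‖((n 0 : ℂ)) ^ 2 + ((n 1 : ℂ)) ^ 2‖ = (n 0 : ℝ) ^ 2 + (n 1 : ℝ) ^ 2 := by
    rw [show ((n 0 : ℂ)) ^ 2 + ((n 1 : ℂ)) ^ 2 = (((n 0 : ℝ) ^ 2 + (n 1 : ℝ) ^ 2 : ℝ) : ℂ) by
      push_cast; rfl, Complex.norm_real, Real.norm_of_nonneg hN.le]
  have h2 : |(n i.castSucc : ℝ)| * |(n 0 : ℝ)| ≤ (n 0 : ℝ) ^ 2 + (n 1 : ℝ) ^ 2 ∧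
      |(n i.castSucc : ℝ)| * |(n 1 : ℝ)| ≤ (n 0 : ℝ) ^ 2 + (n 1 : ℝ) ^ 2 := by
    rw [← sq_abs (n 0 : ℝ), ← sq_abs (n 1 : ℝ)]
    have hi : n i.castSucc = n 0 ∨ n i.castSucc = n 1 := by
      fin_cases i
      · exact Or.inl rfl
      · exact Or.inr rfl
    rcases hi with hi | hi <;> rw [hi] <;> constructor <;>
      nlinarith [sq_nonneg (|(n 0 : ℝ)| - |(n 1 : ℝ)|), sq_nonneg |(n 0 : ℝ)|, sq_nonneg |(n 1 : ℝ)|]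
  rw [norm_mul, norm_neg, norm_div, e, Complex.norm_intCast, div_mul_eq_mul_div, div_le_iff₀ hN]
  have h3 : ‖(n 0 : ℂ) * x + (n 1 : ℂ) * y‖ ≤ |(n 0 : ℝ)| * ‖x‖ + |(n 1 : ℝ)| * ‖y‖ := by
    refine (norm_add_le _ _).trans ?_
    rw [norm_mul, norm_mul, Complex.norm_intCast, Complex.norm_intCast]
  calc _ ≤ |(n i.castSucc : ℝ)| * (|(n 0 : ℝ)| * ‖x‖ + |(n 1 : ℝ)| * ‖y‖) := by gcongr
    _ = (|(n i.castSucc : ℝ)| * |(n 0 : ℝ)|) * ‖x‖ + (|(n i.castSucc : ℝ)| * |(n 1 : ℝ)|) * ‖y‖ := by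
        ring
    _ ≤ ((n 0 : ℝ) ^ 2 + (n 1 : ℝ) ^ 2) * ‖x‖ + ((n 0 : ℝ) ^ 2 + (n 1 : ℝ) ^ 2) * ‖y‖ :=
        add_le_add (mul_le_mul_of_nonneg_right h2.1 (norm_nonneg _))
          (mul_le_mul_of_nonneg_right h2.2 (norm_nonneg _))
    _ = _ := by ring

lemma dec_commProj {b : Fin 3 → Z3 → ℂ} {φ : Fin 2 → Z3 → ℂ} (hb : ∀ j, Dec (b j))
    (hφ : ∀ i, Dec (φ i)) (h : hproj φ = φ) (i : Fin 2) : Dec (commProj b φ i) := by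
  intro r
  obtain ⟨C, hC0, hC⟩ := (dec_transport hb (hφ 0)).bound r
  obtain ⟨D, hD0, hD⟩ := (dec_transport hb (hφ 1)).bound r
  refine ⟨C + D, fun n => ?_⟩
  by_cases hn : n 2 = 0 ∧ ¬(n 0 = 0 ∧ n 1 = 0)
  · rw [commProj_eq h i n hn]
    have := mul_le_mul_of_nonneg_left
      (frac_bound i n hn.2 (transport b (φ 0) n) (transport b (φ 1) n)) (Jr_pos n r).le
    linarith [hC n, hD n]
  · rw [commProj_zero h i n hn]
    simpa using add_nonneg hC0 hD0

/-- The horizontal part of `b` on modes with nonzero vertical frequency. -/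
def bv (b : Fin 3 → Z3 → ℂ) (m : Z3) : ℝ := if m 2 = 0 then 0 else ‖b 0 m‖ + ‖b 1 m‖

lemma transport_eq {b : Fin 3 → Z3 → ℂ} {c : Z3 → ℂ} (hb : ∀ j, Dec (b j)) (hd : DivFree b)
    (hc : Dec c) (n : Z3) (hn : n 2 = 0) :
    (Summable fun m => (2 * Real.pi * I) * ((n 0 : ℂ) * b 0 m + (n 1 : ℂ) * b 1 m) * c (n - m)) ∧
    transport b c n =
      ∑' m, (2 * Real.pi * I) * ((n 0 : ℂ) * b 0 m + (n 1 : ℂ) * b 1 m) * c (n - m) := by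
  have hterm : ∀ j, Summable fun m => b j m * pd j c (n - m) :=
    fun j => conv_summable (hb j) (dec_pd hc j) n
  have e : ∀ m, (2 * Real.pi * I) * ((n 0 : ℂ) * b 0 m + (n 1 : ℂ) * b 1 m) * c (n - m) =
      ∑ j, b j m * pd j c (n - m) := by
    intro m
    have h := hd m
    simp only [Fin.sum_univ_three, pd, Pi.sub_apply, hn] at h ⊢
    push_cast
    linear_combination (2 * Real.pi * I) * c (n - m) * h
  constructor
  · exact (summable_sum fun j _ => hterm j).congr fun m => (e m).symm
  · rw [tsum_congr e, Summable.tsum_finsetSum fun j _ => hterm j]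
    rfl

lemma inner_bound {s : ℝ} (hs : 3 / 2 ≤ s) {b : Fin 3 → Z3 → ℂ} {φ : Fin 2 → Z3 → ℂ}
    (hb : ∀ j, Dec (b j)) (hφ : ∀ i, Dec (φ i)) (hd : DivFree b) (h : hproj φ = φ) (i : Fin 2)
    (n : Z3)
    (hS1 : Summable fun m => (J m ^ (s + 1 / 2) * ∑ j, ‖b j m‖) *
      (J (n - m) ^ (s - 1 / 2) * ∑ i, ‖φ i (n - m)‖))
    (hS2 : Summable fun m => bv b m * (J (n - m) ^ (s + 1 / 2) * ∑ i, ‖φ i (n - m)‖)) :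
    J n ^ (s - 1 / 2) * ‖commProj b φ i n‖ ≤ (2 * Real.pi * (1 + 2 ^ (s - 1 / 2))) *
      (cv (fun m => J m ^ (s + 1 / 2) * ∑ j, ‖b j m‖)
          (fun p => J p ^ (s - 1 / 2) * ∑ i, ‖φ i p‖) n +
        cv (bv b) (fun p => J p ^ (s + 1 / 2) * ∑ i, ‖φ i p‖) n) := by
  have hbv : ∀ m, 0 ≤ bv b m := fun m => by unfold bv; split_ifs <;> positivity
  by_cases hn : n 2 = 0 ∧ ¬(n 0 = 0 ∧ n 1 = 0)
  swap
  · rw [commProj_zero h i n hn, norm_zero, mul_zero]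
    refine mul_nonneg (by positivity) (add_nonneg (tsum_nonneg fun m => ?_) (tsum_nonneg fun m => ?_))
    · have := Jr_pos m (s + 1 / 2); have := Jr_pos (n - m) (s - 1 / 2); positivity
    · have := hbv m; have := Jr_pos (n - m) (s + 1 / 2); positivity
  obtain ⟨s0, t0⟩ := transport_eq hb hd (hφ 0) n hn.1
  obtain ⟨s1, t1⟩ := transport_eq hb hd (hφ 1) n hn.1
  have hJ := Jr_pos n (s - 1 / 2)
  have key : commProj b φ i n = ∑' m, (2 * Real.pi * I) *
      ((n 0 : ℂ) * φ 0 (n - m) + (n 1 : ℂ) * φ 1 (n - m)) *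
      (-((n i.castSucc : ℂ) / (((n 0 : ℂ)) ^ 2 + ((n 1 : ℂ)) ^ 2)) *
        ((n 0 : ℂ) * b 0 m + (n 1 : ℂ) * b 1 m)) := by
    rw [commProj_eq h i n hn, t0, t1, ← tsum_mul_left, ← tsum_mul_left,
      ← (s0.mul_left _).tsum_add (s1.mul_left _), ← tsum_mul_left]
    refine tsum_congr fun m => ?_
    ring
  rw [mul_comm, ← le_div_iff₀ hJ, key, cv, cv, ← hS1.tsum_add hS2, ← tsum_mul_left, ← tsum_div_const]
  refine tsum_of_norm_bounded (((hS1.add hS2).mul_left _).div_const _).hasSum fun m => ?_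
  rw [le_div_iff₀ hJ, norm_mul, norm_mul]
  set p := n - m with hp
  have hnp : n = m + p := by simp [p]
  have hpi : ‖(2 * Real.pi * I : ℂ)‖ = 2 * Real.pi := by
    simp [abs_of_pos Real.pi_pos]
  set Φ := ∑ i, ‖φ i p‖ with hΦ
  have hΦ2 : Φ = ‖φ 0 p‖ + ‖φ 1 p‖ := by rw [hΦ, Fin.sum_univ_two]
  have hlin : ∀ q : Z3, ‖(q 0 : ℂ) * φ 0 p + (q 1 : ℂ) * φ 1 p‖ ≤ J q * Φ := by
    intro q
    refine (norm_add_le _ _).trans ?_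
    rw [norm_mul, norm_mul, Complex.norm_intCast, Complex.norm_intCast, hΦ2, mul_add]
    gcongr <;> exact abs_le_J _ _
  have hsplit : ‖(n 0 : ℂ) * φ 0 p + (n 1 : ℂ) * φ 1 p‖ ≤
      J m * Φ + (if m 2 = 0 then 0 else J p * Φ) := by
    have e : (n 0 : ℂ) * φ 0 p + (n 1 : ℂ) * φ 1 p = ((m 0 : ℂ) * φ 0 p + (m 1 : ℂ) * φ 1 p) +
        ((p 0 : ℂ) * φ 0 p + (p 1 : ℂ) * φ 1 p) := by
      rw [hp]; simp only [Pi.sub_apply]; push_cast; ring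
    rw [e]
    refine (norm_add_le _ _).trans (add_le_add (hlin m) ?_)
    split_ifs with hm
    · rw [orth h p (by rw [hp, Pi.sub_apply, hn.1, hm]; rfl), norm_zero]
    · exact hlin p
  have hfr := frac_bound i n hn.2 (b 0 m) (b 1 m)
  set B := ∑ j, ‖b j m‖ with hB
  have hB2 : ‖b 0 m‖ + ‖b 1 m‖ ≤ B := by
    rw [hB, Fin.sum_univ_three]; linarith [norm_nonneg (b 2 m)]
  have hB0 : 0 ≤ ‖b 0 m‖ + ‖b 1 m‖ := by positivity
  have hΦ0 : 0 ≤ Φ := by rw [hΦ2]; positivity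
  have hJm := J_pos m
  have hJp := J_pos p
  have a1 := Jr_pos m (s - 1 / 2)
  have a2 := Jr_pos p (s - 1 / 2)
  have a3 := Jr_pos m (s + 1 / 2)
  have a4 := Jr_pos p (s + 1 / 2)
  have hm1 : J m ^ (s + 1 / 2) = J m ^ (s - 1 / 2) * J m := by
    nth_rewrite 3 [← Real.rpow_one (J m)]
    rw [← Jr_add]; congr 1; ring
  have hp1 : J p ^ (s + 1 / 2) = J p ^ (s - 1 / 2) * J p := by
    nth_rewrite 3 [← Real.rpow_one (J p)]
    rw [← Jr_add]; congr 1; ring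
  have hpe1 : J n ^ (s - 1 / 2) ≤ J m ^ (s - 1 / 2) * J p ^ (s - 1 / 2) := by
    rw [hnp]; exact Jr_le_mul m p (by linarith)
  have hpe2 : J n ^ (s - 1 / 2) ≤ 2 ^ (s - 1 / 2) * (J m ^ (s - 1 / 2) + J p ^ (s - 1 / 2)) := by
    rw [hnp]; exact Jr_le_add m p (by linarith)
  have hmm : J m ^ (s - 1 / 2) ≤ J m ^ (s + 1 / 2) := Jr_mono m (by linarith)
  have hpp : J p ≤ J p ^ (s - 1 / 2) := by
    nth_rewrite 1 [← Real.rpow_one (J p)]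
    exact Jr_mono p (by linarith)
  set Q : ℝ := 2 ^ (s - 1 / 2) with hQ
  have hQ0 : 0 < Q := by positivity
  have term1 : (J m * Φ) * (‖b 0 m‖ + ‖b 1 m‖) * J n ^ (s - 1 / 2) ≤
      (J m ^ (s + 1 / 2) * B) * (J p ^ (s - 1 / 2) * Φ) := by
    calc _ ≤ (J m * Φ) * B * (J m ^ (s - 1 / 2) * J p ^ (s - 1 / 2)) := by gcongr
      _ = _ := by rw [hm1]; ring
  have term2 : (if m 2 = 0 then 0 else J p * Φ) * (‖b 0 m‖ + ‖b 1 m‖) * J n ^ (s - 1 / 2) ≤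
      Q * ((J m ^ (s + 1 / 2) * B) * (J p ^ (s - 1 / 2) * Φ)) +
      Q * (bv b m * (J p ^ (s + 1 / 2) * Φ)) := by
    unfold bv
    have hB0' : 0 ≤ B := hB0.trans hB2
    split_ifs with hm
    · simp only [zero_mul, mul_zero, add_zero]; positivity
    · calc _ ≤ (J p * Φ) * (‖b 0 m‖ + ‖b 1 m‖) *
            (Q * (J m ^ (s - 1 / 2) + J p ^ (s - 1 / 2))) := by gcongr
        _ = Q * ((J m ^ (s - 1 / 2) * (‖b 0 m‖ + ‖b 1 m‖)) * (J p * Φ)) +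
            Q * ((‖b 0 m‖ + ‖b 1 m‖) * (J p ^ (s + 1 / 2) * Φ)) := by rw [hp1]; ring
        _ ≤ _ := by gcongr
  rw [hpi]
  have hX : 0 ≤ bv b m * (J p ^ (s + 1 / 2) * Φ) := by have := hbv m; positivity
  have hite : 0 ≤ J m * Φ + (if m 2 = 0 then 0 else J p * Φ) := by split_ifs <;> positivity
  calc _ ≤ 2 * Real.pi * (J m * Φ + (if m 2 = 0 then 0 else J p * Φ)) *
        (‖b 0 m‖ + ‖b 1 m‖) * J n ^ (s - 1 / 2) := by gcongr
    _ = 2 * Real.pi * ((J m * Φ) * (‖b 0 m‖ + ‖b 1 m‖) * J n ^ (s - 1 / 2) +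
        (if m 2 = 0 then 0 else J p * Φ) * (‖b 0 m‖ + ‖b 1 m‖) * J n ^ (s - 1 / 2)) := by ring
    _ ≤ 2 * Real.pi * ((1 + Q) * ((J m ^ (s + 1 / 2) * B) * (J p ^ (s - 1 / 2) * Φ) +
        bv b m * (J p ^ (s + 1 / 2) * Φ))) := by
        refine mul_le_mul_of_nonneg_left ?_ (by positivity)
        linarith
    _ = _ := by ring

/-! ### The `ℓ¹` bounds for `b` -/

lemma bv_bound {b : Fin 3 → Z3 → ℂ} {σ : ℝ} (m : Z3) :
    bv b m ≤ (if m 2 = 0 then 0 else J m ^ (-σ) / |(m 2 : ℝ)|) *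
      (J m ^ σ * ∑ i, ‖dzbh b i m‖) := by
  unfold bv
  split_ifs with hm
  · simp
  have hm1 : 1 ≤ |(m 2 : ℝ)| := by exact_mod_cast Int.one_le_abs hm
  have hm0 : 0 < |(m 2 : ℝ)| := by linarith
  have hd : ∀ i : Fin 2, ‖dzbh b i m‖ = 2 * Real.pi * |(m 2 : ℝ)| * ‖b i.castSucc m‖ := by
    intro i
    unfold dzbh pd
    rw [norm_mul, norm_mul, Complex.norm_I, one_mul, Complex.norm_real, norm_mul,
      Real.norm_of_nonneg (by positivity), Real.norm_eq_abs]
  have hJ : J m ^ (-σ) * J m ^ σ = 1 := by rw [← Jr_add]; simp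
  have c0 : (Fin.castSucc (0 : Fin 2)) = (0 : Fin 3) := rfl
  have c1 : (Fin.castSucc (1 : Fin 2)) = (1 : Fin 3) := rfl
  rw [Fin.sum_univ_two, hd, hd, c0, c1]
  have e : J m ^ (-σ) / |(m 2 : ℝ)| * (J m ^ σ * (2 * Real.pi * |(m 2 : ℝ)| * ‖b 0 m‖ +
      2 * Real.pi * |(m 2 : ℝ)| * ‖b 1 m‖)) = (J m ^ (-σ) * J m ^ σ) * (2 * Real.pi) *
      (‖b 0 m‖ + ‖b 1 m‖) := by field_simp
  rw [e, hJ, one_mul]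
  have : 0 ≤ ‖b 0 m‖ + ‖b 1 m‖ := by positivity
  nlinarith [two_pi_ge]

lemma hnormV3_sq (σ : ℝ) (b : Fin 3 → Z3 → ℂ) : hnormV3 σ b ^ 2 = ∑ j, hnorm σ (b j) ^ 2 :=
  Real.sq_sqrt (Finset.sum_nonneg fun _ _ => sq_nonneg _)

lemma hnormV2_sq (σ : ℝ) (b : Fin 2 → Z3 → ℂ) : hnormV2 σ b ^ 2 = ∑ j, hnorm σ (b j) ^ 2 :=
  Real.sq_sqrt (Finset.sum_nonneg fun _ _ => sq_nonneg _)

lemma cv_nonneg {F G : Z3 → ℝ} (hF : ∀ i, 0 ≤ F i) (hG : ∀ i, 0 ≤ G i) (n : Z3) : 0 ≤ cv F G n :=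
  tsum_nonneg fun m => mul_nonneg (hF m) (hG _)

set_option maxHeartbeats 2000000 in
theorem main (s : ℝ) (hs : 5 / 2 < s) :
    ∃ C : ℝ, 0 < C ∧
      ∀ b : Fin 3 → Z3 → ℂ, SmoothV3 b → DivFree b →
        ∀ φ : Fin 2 → Z3 → ℂ, SmoothV2 φ → hproj φ = φ →
          l2normV (lamV (-(1 / 2)) (commLamV s b (commProj b φ))) ≤
            C * (hnormV3 (s + 3) b ^ 2 * hnormV2 (s - 1 / 2) φ +
                 hnormV3 (s + 3) b * hnormV2 (s - 3 / 2) (dzbh b) * hnormV2 (s + 1 / 2) φ) := by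
  set a := min (5 / 3) (s - 3 / 2) with ha_def
  have ha : 1 < a := lt_min (by norm_num) (by linarith)
  have ha1 : a ≤ 5 / 3 := min_le_left _ _
  have ha2 : a ≤ s - 3 / 2 := min_le_right _ _
  set T := ∑' m, P a m with hT
  have hT0 : 0 ≤ T := tsum_nonneg fun m => P_nonneg a m
  -- constants
  set K1 : ℝ := (1 * T) * (3 * 2 ^ (2 * (s + 3))) with hK1
  set K2 : ℝ := (4 * T) * (2 * 2 ^ (2 * (s - 3 / 2))) with hK2
  set K3 : ℝ := 2 * 2 ^ (2 * (s - 1 / 2)) with hK3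
  set K4 : ℝ := 2 * 2 ^ (2 * (s + 1 / 2)) with hK4
  set K5 : ℝ := 2 * Real.pi * (1 + 2 ^ (s - 1 / 2)) with hK5
  have h1 : 0 ≤ K1 := by positivity
  have h2 : 0 ≤ K2 := by positivity
  have h3 : 0 ≤ K3 := by positivity
  have h4 : 0 ≤ K4 := by positivity
  set K : ℝ := 2 * ((2 * s) ^ 2 * K1 * (2 * K5 ^ 2 * (K1 * K3 + K2 * K4))) with hK
  have hK0 : 0 ≤ K := by positivity
  refine ⟨√K + 1, by positivity, ?_⟩
  intro b hb hd φ hφ hP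
  have hbD : ∀ j, Dec (b j) := fun j => dec_of_rapid (hb j).2
  have hφD : ∀ j, Dec (φ j) := fun j => dec_of_rapid (hφ j).2
  have hdD : ∀ i, Dec (dzbh b i) := fun i => dec_pd (hbD _) 2
  set B := hnormV3 (s + 3) b with hB
  set D := hnormV2 (s - 3 / 2) (dzbh b) with hD
  set Φ1 := hnormV2 (s - 1 / 2) φ with hΦ1
  set Φ2 := hnormV2 (s + 1 / 2) φ with hΦ2
  have hB0 : 0 ≤ B := Real.sqrt_nonneg _
  have hD0 : 0 ≤ D := Real.sqrt_nonneg _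
  have hΦ10 : 0 ≤ Φ1 := Real.sqrt_nonneg _
  have hΦ20 : 0 ≤ Φ2 := Real.sqrt_nonneg _
  set F1 : Z3 → ℝ := fun m => J m ^ (s + 1 / 2) * ∑ j, ‖b j m‖ with hF1
  set G1 : Z3 → ℝ := fun p => J p ^ (s - 1 / 2) * ∑ i, ‖φ i p‖ with hG1
  set G2 : Z3 → ℝ := fun p => J p ^ (s + 1 / 2) * ∑ i, ‖φ i p‖ with hG2
  have hF10 : ∀ m, 0 ≤ F1 m := fun m => mul_nonneg (Jr_pos _ _).le (by positivity)
  have hG10 : ∀ m, 0 ≤ G1 m := fun m => mul_nonneg (Jr_pos _ _).le (by positivity)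
  have hG20 : ∀ m, 0 ≤ G2 m := fun m => mul_nonneg (Jr_pos _ _).le (by positivity)
  have hbv0 : ∀ m, 0 ≤ bv b m := fun m => by unfold bv; split_ifs <;> positivity
  -- the `ℓ¹` bound on `b`
  obtain ⟨hVs, hVb⟩ := hsqV (σ := s + 3) (by linarith) hbD
  simp only [Nat.cast_ofNat] at hVb
  have hF : Summable F1 ∧ (∑' m, F1 m) ^ 2 ≤ K1 * B ^ 2 := by
    obtain ⟨q1, q2⟩ := l1bound (K := 1) ha hF10 (u := fun m => J m ^ (-(5 / 2) : ℝ))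
      (v := fun m => J m ^ (s + 3) * ∑ j, ‖b j m‖)
      (fun m => (Jr_pos _ _).le) (fun m => mul_nonneg (Jr_pos _ _).le (by positivity))
      (fun m => by
        rw [← mul_assoc, ← Jr_add]
        apply le_of_eq
        simp only [hF1]
        congr 2; ring)
      (fun m => by
        rw [Jr_sq, one_mul]
        refine le_trans (le_of_eq ?_) (Jneg_le_P (by linarith) ha1 m)
        congr 1; norm_num) hVs
    refine ⟨q1, q2.trans ?_⟩
    rw [hB, hnormV3_sq, hK1, mul_assoc (1 * T)]
    exact mul_le_mul_of_nonneg_left hVb (by linarith : (0 : ℝ) ≤ 1 * T)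
  -- the `ℓ¹` bound on the vertical part
  obtain ⟨hWs, hWb⟩ := hsqV (σ := s - 3 / 2) (by linarith) hdD
  simp only [Nat.cast_ofNat] at hWb
  have hβ : Summable (bv b) ∧ (∑' m, bv b m) ^ 2 ≤ K2 * D ^ 2 := by
    obtain ⟨q1, q2⟩ := l1bound (K := 4) ha hbv0
      (u := fun m => if m 2 = 0 then 0 else J m ^ (-(s - 3 / 2)) / |(m 2 : ℝ)|)
      (v := fun m => J m ^ (s - 3 / 2) * ∑ j, ‖dzbh b j m‖)
      (fun m => by
        have := Jr_pos m (-(s - 3 / 2))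
        split_ifs <;> positivity)
      (fun m => mul_nonneg (Jr_pos _ _).le (by positivity))
      (fun m => bv_bound m)
      (fun m => by
        split_ifs with hm
        · have := P_nonneg a m
          simpa using this
        · exact Jneg_le_P' (by linarith) ha2 (by linarith) m hm) hWs
    refine ⟨q1, q2.trans ?_⟩
    rw [hD, hnormV2_sq, hK2, mul_assoc (4 * T)]
    exact mul_le_mul_of_nonneg_left hWb (by linarith : (0 : ℝ) ≤ 4 * T)
  -- the `ℓ²` bounds on `φ`
  obtain ⟨hG1s, hG1b⟩ := hsqV (σ := s - 1 / 2) (by linarith) hφD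
  obtain ⟨hG2s, hG2b⟩ := hsqV (σ := s + 1 / 2) (by linarith) hφD
  rw [← hnormV2_sq, ← hΦ1, Nat.cast_ofNat, ← hK3] at hG1b
  rw [← hnormV2_sq, ← hΦ2, Nat.cast_ofNat, ← hK4] at hG2b
  obtain ⟨y1, y2, y3⟩ := young hF10 hG10 hF.1 hG1s
  obtain ⟨z1, z2, z3⟩ := young hbv0 hG20 hβ.1 hG2s
  have hψD := dec_commProj hbD hφD hP
  have hψs : ∀ i, Summable fun n => (J n ^ (s - 1 / 2) * ‖commProj b φ i n‖) ^ 2 :=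
    fun i => (hψD i).summable_sq _
  have hψ : ∀ i, ∑' n, (J n ^ (s - 1 / 2) * ‖commProj b φ i n‖) ^ 2 ≤
      2 * K5 ^ 2 * (K1 * K3 + K2 * K4) * (B * Φ1 + D * Φ2) ^ 2 := by
    intro i
    have hpt : ∀ n, (J n ^ (s - 1 / 2) * ‖commProj b φ i n‖) ^ 2 ≤
        2 * K5 ^ 2 * (cv F1 G1 n ^ 2 + cv (bv b) G2 n ^ 2) := by
      intro n
      have hin := inner_bound (s := s) (by linarith) hbD hφD hd hP i n (y1 n) (z1 n)
      have h0 : 0 ≤ J n ^ (s - 1 / 2) * ‖commProj b φ i n‖ :=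
        mul_nonneg (Jr_pos _ _).le (norm_nonneg _)
      calc _ ≤ (K5 * (cv F1 G1 n + cv (bv b) G2 n)) ^ 2 := pow_le_pow_left₀ h0 hin 2
        _ ≤ _ := by
          rw [mul_pow]
          nlinarith [mul_nonneg (sq_nonneg K5) (sq_nonneg (cv F1 G1 n - cv (bv b) G2 n))]
    have hle := (hψs i).tsum_le_tsum hpt ((y2.add z2).mul_left _)
    rw [tsum_mul_left, y2.tsum_add z2] at hle
    have w1 : ∑' n, cv F1 G1 n ^ 2 ≤ (K1 * B ^ 2) * (K3 * Φ1 ^ 2) :=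
      y3.trans (mul_le_mul hF.2 hG1b (tsum_nonneg fun _ => sq_nonneg _)
        (by positivity))
    have w2 : ∑' n, cv (bv b) G2 n ^ 2 ≤ (K2 * D ^ 2) * (K4 * Φ2 ^ 2) :=
      z3.trans (mul_le_mul hβ.2 hG2b (tsum_nonneg fun _ => sq_nonneg _)
        (by positivity))
    refine hle.trans ?_
    rw [mul_assoc (2 * K5 ^ 2)]
    refine mul_le_mul_of_nonneg_left ?_ (by positivity)
    have e1 : (B * Φ1) ^ 2 ≤ (B * Φ1 + D * Φ2) ^ 2 :=
      pow_le_pow_left₀ (by positivity) (by linarith [mul_nonneg hD0 hΦ20]) 2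
    have e2 : (D * Φ2) ^ 2 ≤ (B * Φ1 + D * Φ2) ^ 2 :=
      pow_le_pow_left₀ (by positivity) (by linarith [mul_nonneg hB0 hΦ10]) 2
    have e3 := mul_le_mul_of_nonneg_left e1 (mul_nonneg h1 h3)
    have e4 := mul_le_mul_of_nonneg_left e2 (mul_nonneg h2 h4)
    calc _ ≤ (K1 * B ^ 2) * (K3 * Φ1 ^ 2) + (K2 * D ^ 2) * (K4 * Φ2 ^ 2) := add_le_add w1 w2
      _ = K1 * K3 * (B * Φ1) ^ 2 + K2 * K4 * (D * Φ2) ^ 2 := by ring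
      _ ≤ K1 * K3 * (B * Φ1 + D * Φ2) ^ 2 + K2 * K4 * (B * Φ1 + D * Φ2) ^ 2 := add_le_add e3 e4
      _ = _ := by ring
  have hout : ∀ i, l2sq (lamV (-(1 / 2)) (commLamV s b (commProj b φ)) i) ≤
      (2 * s) ^ 2 * ((K1 * B ^ 2) * (2 * K5 ^ 2 * (K1 * K3 + K2 * K4) * (B * Φ1 + D * Φ2) ^ 2)) := by
    intro i
    have hG0 : ∀ p, 0 ≤ J p ^ (s - 1 / 2) * ‖commProj b φ i p‖ :=
      fun p => mul_nonneg (Jr_pos _ _).le (norm_nonneg _)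
    obtain ⟨v1, v2, v3⟩ := young hF10 hG0 hF.1 (hψs i)
    have hpt : ∀ n, ‖lamV (-(1 / 2)) (commLamV s b (commProj b φ)) i n‖ ^ 2 ≤
        (2 * s) ^ 2 * cv F1 (fun p => J p ^ (s - 1 / 2) * ‖commProj b φ i p‖) n ^ 2 := by
      intro n
      rw [← mul_pow]
      exact pow_le_pow_left₀ (norm_nonneg _)
        (outer (s := s) (by linarith) hbD (hψD i) n (v1 n)) 2
    have hsum := Summable.of_nonneg_of_le (fun n => sq_nonneg _) hpt (v2.mul_left _)
    have hle := hsum.tsum_le_tsum hpt (v2.mul_left _)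
    rw [tsum_mul_left] at hle
    refine hle.trans (mul_le_mul_of_nonneg_left (v3.trans ?_) (sq_nonneg _))
    exact mul_le_mul hF.2 (hψ i) (tsum_nonneg fun _ => sq_nonneg _) (by positivity)
  have hfin : ∑ i : Fin 2, l2sq (lamV (-(1 / 2)) (commLamV s b (commProj b φ)) i) ≤
      K * (B ^ 2 * Φ1 + B * D * Φ2) ^ 2 := by
    rw [Fin.sum_univ_two]
    have := hout 0
    have := hout 1
    calc _ ≤ 2 * ((2 * s) ^ 2 * ((K1 * B ^ 2) *
          (2 * K5 ^ 2 * (K1 * K3 + K2 * K4) * (B * Φ1 + D * Φ2) ^ 2))) := by linarith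
      _ = _ := by rw [hK]; ring
  have hR : 0 ≤ B ^ 2 * Φ1 + B * D * Φ2 := by positivity
  unfold l2normV
  calc _ ≤ √(K * (B ^ 2 * Φ1 + B * D * Φ2) ^ 2) := Real.sqrt_le_sqrt hfin
    _ = √K * (B ^ 2 * Φ1 + B * D * Φ2) := by rw [Real.sqrt_mul hK0, Real.sqrt_sq hR]
    _ ≤ _ := by nlinarith

end Aux4

/-- Let `s > 5/2`. There is `C = C(s) > 0` such that for every smooth
divergence-free vector field `b = (b¹,b²,b³)` on `𝕋³` and every smooth ℝ²-valued `φ`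
with `𝒫φ = φ`,
`‖Λ^{−1/2} [Λ^s, b·∇] [𝒫, b·∇] φ‖_{L²} ≤ C (‖b‖²_{H^{s+3}} ‖φ‖_{H^{s−1/2}}
 + ‖b‖_{H^{s+3}} ‖∂_z(b¹,b²)‖_{H^{s−3/2}} ‖φ‖_{H^{s+1/2}})`. -/
theorem stmt4 (s : ℝ) (hs : 5 / 2 < s) :
    ∃ C : ℝ, 0 < C ∧
      ∀ b : Fin 3 → Z3 → ℂ, SmoothV3 b → DivFree b →
        ∀ φ : Fin 2 → Z3 → ℂ, SmoothV2 φ → hproj φ = φ →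
          l2normV (lamV (-(1 / 2)) (commLamV s b (commProj b φ))) ≤
            C * (hnormV3 (s + 3) b ^ 2 * hnormV2 (s - 1 / 2) φ +
                 hnormV3 (s + 3) b * hnormV2 (s - 3 / 2) (dzbh b) * hnormV2 (s + 1 / 2) φ) := by
  exact Aux4.main s hs
end
end
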